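/- Let d ≥ 1 and let G=(V,E) be a d-rigid graph. Let xy ∈ E be an ℛ_d-bridge in G with deg_G(y) ≥ d+2, and suppose that the vertices in N_G(y)∖{x} are pairwise globally d-linked in G−y. Let {u,v} be a pair of vertices with y ∉ {u,v} such that {u,v} is not globally d-linked in G−y. Then {u,v} is not globally d-linked in G. -/

import Mathlib

open scoped BigOperators

noncomputable section

namespace Rigidity

variable {V : Type*}

/-- Euclidean distance between two points of `ℝ^d` (given as coordinate functions). -/
def eDist {d : ℕ} (x y : Fin d → ℝ) : ℝ := Real.sqrt (∑ i, (x i - y i) ^ 2)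

/-- Two frameworks `(G,p)` and `(G,q)` are equivalent if corresponding edge lengths agree. -/
def Equivalent {d : ℕ} (G : SimpleGraph V) (p q : V → Fin d → ℝ) : Prop :=
  ∀ u v : V, G.Adj u v → eDist (p u) (p v) = eDist (q u) (q v)

/-- Two placements are congruent if all pairwise distances agree. -/
def Congruent {d : ℕ} (p q : V → Fin d → ℝ) : Prop :=
  ∀ u v : V, eDist (p u) (p v) = eDist (q u) (q v)

/-- A placement is generic if the multiset of its coordinates is algebraically
independent over `ℚ`. -/
def Generic {d : ℕ} (p : V → Fin d → ℝ) : Prop :=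
  AlgebraicIndependent ℚ (fun vi : V × Fin d => p vi.1 vi.2)

/-- `{u,v}` is globally linked in the framework `(G,p)`. -/
def GloballyLinkedIn {d : ℕ} (G : SimpleGraph V) (p : V → Fin d → ℝ) (u v : V) : Prop :=
  ∀ q : V → Fin d → ℝ, Equivalent G p q → eDist (q u) (q v) = eDist (p u) (p v)

/-- `{u,v}` is globally `d`-linked in `G`. -/
def GloballyLinked (d : ℕ) (G : SimpleGraph V) (u v : V) : Prop :=
  ∀ p : V → Fin d → ℝ, Generic p → GloballyLinkedIn G p u v

/-- The framework `(G,p)` is rigid. -/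
def RigidFramework {d : ℕ} (G : SimpleGraph V) (p : V → Fin d → ℝ) : Prop :=
  ∃ ε > (0:ℝ), ∀ q : V → Fin d → ℝ, Equivalent G p q →
    (∀ v, eDist (p v) (q v) < ε) → Congruent p q

/-- `G` is `d`-rigid: every generic framework of `G` in `ℝ^d` is rigid. -/
def IsRigidGraph (d : ℕ) (G : SimpleGraph V) : Prop :=
  ∀ p : V → Fin d → ℝ, Generic p → RigidFramework G p

/-- The framework `(G,p)` is globally rigid. -/
def GloballyRigidFramework {d : ℕ} (G : SimpleGraph V) (p : V → Fin d → ℝ) : Prop :=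
  ∀ q : V → Fin d → ℝ, Equivalent G p q → Congruent p q

/-- The row of the rigidity matrix corresponding to the (ordered) edge `(u,v)`. -/
def edgeVec [DecidableEq V] {d : ℕ} (p : V → Fin d → ℝ) (u v : V) : V × Fin d → ℝ :=
  fun wi => if wi.1 = u then p u wi.2 - p v wi.2
            else if wi.1 = v then p v wi.2 - p u wi.2 else 0

/-- The rank of the set of rows of the rigidity matrix of `(·,p)` indexed by `F`. -/
def rankAt [DecidableEq V] (d : ℕ) (p : V → Fin d → ℝ) (F : Set (Sym2 V)) : ℕ :=
  Module.finrank ℝ (Submodule.span ℝ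
    {x : V × Fin d → ℝ | ∃ u v : V, s(u, v) ∈ F ∧ x = edgeVec p u v})

/-- `r_d(F)`: the rank of the set of rows indexed by `F` of the rigidity matrix of a
generic framework, equivalently the maximum of this rank over all placements. -/
def rd [DecidableEq V] (d : ℕ) (F : Set (Sym2 V)) : ℕ :=
  sSup {n : ℕ | ∃ p : V → Fin d → ℝ, n = rankAt d p F}

/-- An edge set is `ℛ_d`-independent if its rank equals its cardinality. -/
def RdIndep [DecidableEq V] (d : ℕ) (F : Set (Sym2 V)) : Prop := rd d F = F.ncard

/-- An `ℛ_d`-circuit: not independent, but every proper subset is independent. -/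
def RdCircuit [DecidableEq V] (d : ℕ) (C : Set (Sym2 V)) : Prop :=
  ¬ RdIndep d C ∧ ∀ C' : Set (Sym2 V), C' ⊂ C → RdIndep d C'

/-- An `ℛ_d`-circuit of the graph `G`. -/
def RdCircuitOf [DecidableEq V] (d : ℕ) (G : SimpleGraph V) (C : Set (Sym2 V)) : Prop :=
  C ⊆ G.edgeSet ∧ RdCircuit d C

/-- `F` is (the edge set of) an `ℛ_d`-component of `G`: an equivalence class of the
relation "`e = f` or some `ℛ_d`-circuit of `G` contains both `e` and `f`". -/
def IsRdComponent [DecidableEq V] (d : ℕ) (G : SimpleGraph V) (F : Set (Sym2 V)) : Prop :=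
  ∃ e ∈ G.edgeSet, F = {f | f ∈ G.edgeSet ∧
    (e = f ∨ ∃ C, RdCircuitOf d G C ∧ e ∈ C ∧ f ∈ C)}

/-- The set of vertices covered by an edge set. -/
def vertexSpan (F : Set (Sym2 V)) : Set V := {v | ∃ e ∈ F, v ∈ e}

/-- A nonempty edge set is `ℛ_d`-connected if any two of its edges lie on a common
`ℛ_d`-circuit contained in it (or are equal). -/
def RdConnectedSet [DecidableEq V] (d : ℕ) (F : Set (Sym2 V)) : Prop :=
  F.Nonempty ∧ ∀ e ∈ F, ∀ f ∈ F, e = f ∨ ∃ C, C ⊆ F ∧ RdCircuit d C ∧ e ∈ C ∧ f ∈ C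

/-- A graph (with at least one edge) is `ℛ_d`-connected. -/
def RdConnected [DecidableEq V] (d : ℕ) (H : SimpleGraph V) : Prop :=
  RdConnectedSet d H.edgeSet

/-- `e` is an `ℛ_d`-bridge of `G`: `r_d(E ∖ {e}) = r_d(E) − 1`. -/
def IsRdBridge [DecidableEq V] (d : ℕ) (G : SimpleGraph V) (e : Sym2 V) : Prop :=
  e ∈ G.edgeSet ∧ rd d (G.edgeSet \ {e}) + 1 = rd d G.edgeSet

/-- `G + uv`. -/
def addEdge (G : SimpleGraph V) (u v : V) : SimpleGraph V :=
  G ⊔ SimpleGraph.fromEdgeSet {s(u, v)}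

/-- `{u,v}` is `d`-linked in `G` if `r_d(G+uv) = r_d(G)`. -/
def IsLinked [DecidableEq V] (d : ℕ) (G : SimpleGraph V) (u v : V) : Prop :=
  rd d (addEdge G u v).edgeSet = rd d G.edgeSet

/-- There exist `k` pairwise internally vertex-disjoint `u`–`v` paths in `H`
(i.e. `κ_H(u,v) ≥ k`). -/
def InternallyDisjointPaths (H : SimpleGraph V) (u v : V) (k : ℕ) : Prop :=
  ∃ P : Fin k → H.Walk u v, (∀ i, (P i).IsPath) ∧
    ∀ i j, i ≠ j → ∀ w, w ∈ (P i).support → w ∈ (P j).support → w = u ∨ w = v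

/-- An unordered pair forming a 2-separator: two distinct vertices whose deletion
disconnects the graph. -/
def TwoSepPair (H : SimpleGraph V) (e : Sym2 V) : Prop :=
  ¬ e.IsDiag ∧ ¬ (H.induce {v | v ∉ e}).Connected

/-- The augmented graph `Ĥ`: add an edge for every 2-separator. -/
def aug (H : SimpleGraph V) : SimpleGraph V :=
  H ⊔ SimpleGraph.fromEdgeSet {e | TwoSepPair H e}

/-- A subgraph is 3-connected: at least 4 vertices, and deleting fewer than 3
vertices leaves it connected. -/
def IsThreeConnectedSubgraph {G : SimpleGraph V} (J : G.Subgraph) : Prop :=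
  4 ≤ J.verts.ncard ∧ ∀ S : Set V, S.ncard < 3 → (J.deleteVerts S).coe.Connected

/-- A 3-block of `H`: a maximal 3-connected subgraph of the augmented graph `Ĥ`. -/
def IsThreeBlock (H : SimpleGraph V) (J : (aug H).Subgraph) : Prop :=
  IsThreeConnectedSubgraph J ∧
    ∀ J' : (aug H).Subgraph, IsThreeConnectedSubgraph J' → J ≤ J' → J = J'

/-- `h_H(e)`: the number of 3-blocks of `H` containing both vertices of `e`. -/
def numBlocksOn (H : SimpleGraph V) (e : Sym2 V) : ℕ :=
  {J : (aug H).Subgraph | IsThreeBlock H J ∧ ∀ v ∈ e, v ∈ J.verts}.ncard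

open Classical in
/-- `k(H) = Σ (h_H(ab) − 1)` over all 2-separators `{a,b}` of `H`. -/
def kGraph [Fintype V] [DecidableEq V] (H : SimpleGraph V) : ℕ :=
  ∑ e : Sym2 V, if TwoSepPair H e then numBlocksOn H e - 1 else 0

/-- The graph of an `ℛ₂`-component, on its own vertex set. -/
def componentGraph [DecidableEq V] (F : Set (Sym2 V)) :
    SimpleGraph (vertexSpan F) :=
  (SimpleGraph.fromEdgeSet F).induce (vertexSpan F)

/-- `X` is the vertex set of an `ℛ_d`-block of `G`: a 3-block of a non-trivial
`ℛ_d`-component of `G`. -/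
def IsRdBlockVerts [DecidableEq V] (d : ℕ) (G : SimpleGraph V) (X : Set V) : Prop :=
  ∃ F : Set (Sym2 V), IsRdComponent d G F ∧ 2 ≤ F.ncard ∧
    ∃ J : (aug (componentGraph F)).Subgraph,
      IsThreeBlock (componentGraph F) J ∧ X = Subtype.val '' J.verts

/-- The globally linked closure of `G` in `ℝ^d`. -/
def glc (d : ℕ) (G : SimpleGraph V) : SimpleGraph V :=
  G ⊔ SimpleGraph.fromEdgeSet {e | ∃ u v : V, e = s(u, v) ∧ GloballyLinked d G u v}

/-- A globally `d`-linked cluster: the vertex set of a maximal complete subgraph of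
`glc_d(G)`. -/
def IsCluster (d : ℕ) (G : SimpleGraph V) (X : Set V) : Prop :=
  (∀ a ∈ X, ∀ b ∈ X, a ≠ b → (glc d G).Adj a b) ∧
    ∀ Y : Set V, X ⊆ Y → (∀ a ∈ Y, ∀ b ∈ Y, a ≠ b → (glc d G).Adj a b) → Y = X

/-- Equilibrium stress of a framework, encoded as a symmetric function vanishing on
non-edges. -/
def IsEqStress [Fintype V] {d : ℕ} (G : SimpleGraph V) (p : V → Fin d → ℝ)
    (ω : V → V → ℝ) : Prop :=
  (∀ u v, ω u v = ω v u) ∧ (∀ u v, ¬ G.Adj u v → ω u v = 0) ∧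
    ∀ u, ∑ v, ω u v • (p u - p v) = 0

/-- `{u,v}` is `d`-stress-linked in `G`. -/
def StressLinked [Fintype V] (d : ℕ) (G : SimpleGraph V) (u v : V) : Prop :=
  ∀ p : V → Fin d → ℝ, Generic p → ∀ q : V → Fin d → ℝ,
    (∀ ω, IsEqStress G p ω → IsEqStress G q ω) →
    ∀ ω, IsEqStress (addEdge G u v) p ω → IsEqStress (addEdge G u v) q ω

/-- Equivalence of complex frameworks. -/
def CEquivalent {d : ℕ} (G : SimpleGraph V) (p q : V → Fin d → ℂ) : Prop :=
  ∀ u v : V, G.Adj u v →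
    ∑ i, (p u i - p v i) ^ 2 = ∑ i, (q u i - q v i) ^ 2

/-- Generic complex placement. -/
def CGeneric {d : ℕ} (p : V → Fin d → ℂ) : Prop :=
  AlgebraicIndependent ℚ (fun vi : V × Fin d => p vi.1 vi.2)

/-- `{u,v}` is globally linked in `G` in `ℂ^d`. -/
def CGloballyLinked (d : ℕ) (G : SimpleGraph V) (u v : V) : Prop :=
  ∀ p : V → Fin d → ℂ, CGeneric p → ∀ q : V → Fin d → ℂ, CEquivalent G p q →
    ∑ i, (q u i - q v i) ^ 2 = ∑ i, (p u i - p v i) ^ 2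

/-- A flexing of the framework `(G,q)`. -/
def IsFlexing {d : ℕ} (G : SimpleGraph V) (q : V → Fin d → ℝ)
    (φ : Set.Icc (0:ℝ) 1 → V → Fin d → ℝ) : Prop :=
  Continuous φ ∧ φ ⟨0, Set.left_mem_Icc.mpr zero_le_one⟩ = q ∧
    (∀ t, Equivalent G q (φ t)) ∧
    ∀ t : Set.Icc (0:ℝ) 1, 0 < (t : ℝ) → ¬ Congruent q (φ t)

/-- A finite loopless multigraph on vertex type `V` with edge type `E`. -/
structure Multigraph (V : Type*) (E : Type*) where
  ends : E → Sym2 V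
  loopless : ∀ e, ¬ (ends e).IsDiag

/-- The data `(B, bar)` exhibits `G` as a body-bar graph induced by `H`. -/
def IsBodyBar {V E W : Type*} (H : Multigraph V E) (G : SimpleGraph W)
    (B : V → Set W) (bar : E → W × W) : Prop :=
  (∀ w : W, ∃! v : V, w ∈ B v) ∧
  (∀ v : V, (B v).ncard = {e : E | v ∈ H.ends e}.ncard) ∧
  (∀ e : E, ∃ w z : V, H.ends e = s(w, z) ∧ (bar e).1 ∈ B w ∧ (bar e).2 ∈ B z) ∧
  (∀ e : E, (bar e).1 ≠ (bar e).2) ∧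
  (∀ e e' : E, e ≠ e' →
    ({(bar e).1, (bar e).2} ∩ {(bar e').1, (bar e').2} : Set W) = ∅) ∧
  (∀ a b : W, G.Adj a b ↔ a ≠ b ∧
    ((∃ v : V, a ∈ B v ∧ b ∈ B v) ∨ ∃ e : E, s(a, b) = s((bar e).1, (bar e).2)))

/-- `P` is a partition of the set `X`. -/
def IsPartitionOf {V : Type*} (X : Set V) (P : Set (Set V)) : Prop :=
  (∀ p ∈ P, p.Nonempty ∧ p ⊆ X) ∧ ∀ v ∈ X, ∃! p, p ∈ P ∧ v ∈ p

/-- The subgraph `(X,F)` of the multigraph `H` is `k`-tree-connected. -/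
def SubTreeConnected {V E : Type*} (k : ℕ) (H : Multigraph V E)
    (X : Set V) (F : Set E) : Prop :=
  X.Nonempty ∧ (∀ e ∈ F, ∀ v ∈ H.ends e, v ∈ X) ∧
    ∀ P : Set (Set V), IsPartitionOf X P →
      k * (P.ncard - 1) ≤ {e | e ∈ F ∧ ¬ ∃ p ∈ P, ∀ v ∈ H.ends e, v ∈ p}.ncard

/-- `(X,F)` is a `k`-superbrick of `H`: a maximal `k`-tree-connected subgraph. -/
def IsSuperbrick {V E : Type*} (k : ℕ) (H : Multigraph V E)
    (X : Set V) (F : Set E) : Prop :=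
  SubTreeConnected k H X F ∧
    ∀ X' F', SubTreeConnected k H X' F' → X ⊆ X' → F ⊆ F' → X = X' ∧ F = F'

section Differentials
open KaehlerDifferential TensorProduct

open scoped IntermediateField.algebraAdjoinAdjoin in
theorem formallyEtale_of_isTranscendenceBasis {K L ι : Type*} [Field K] [Field L] [Algebra K L]
    [CharZero K] {x : ι → L} (hx : IsTranscendenceBasis K x) :
    Algebra.FormallyEtale (Algebra.adjoin K (Set.range x)) L := by
  have h1 : Algebra.FormallyEtale (Algebra.adjoin K (Set.range x))
      (IntermediateField.adjoin K (Set.range x)) :=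
    .of_isLocalization (nonZeroDivisors _)
  have h2 : Algebra.IsAlgebraic (IntermediateField.adjoin K (Set.range x)) L :=
    hx.isAlgebraic_field
  have h3 : Algebra.FormallyEtale (IntermediateField.adjoin K (Set.range x)) L :=
    Algebra.FormallyEtale.of_isSeparable _ L
  exact .comp _ (IntermediateField.adjoin K (Set.range x)) _

theorem _root_.IsTranscendenceBasis.linearIndependent_D {K L ι : Type*} [Field K] [Field L]
    [Algebra K L] [CharZero K] {x : ι → L} (hx : IsTranscendenceBasis K x) :
    LinearIndependent L (fun i => D K L (x i)) := by
  classical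
  have := formallyEtale_of_isTranscendenceBasis hx
  let S := Algebra.adjoin K (Set.range x)
  let e : MvPolynomial ι K ≃ₐ[K] S := hx.1.aevalEquiv
  rw [linearIndependent_iff']
  intro s c hc j hj
  -- the partial derivative with respect to the `j`-th element of the basis
  let d₀ : Derivation K (MvPolynomial ι K) (MvPolynomial ι K) := MvPolynomial.pderiv j
  let d : Derivation K S S := Derivation.mk' (e.toLinearMap ∘ₗ d₀.toLinearMap ∘ₗ e.symm.toLinearMap)
    (by intro a b; simp [d₀])
  let d' : Derivation K S L := (Algebra.linearMap S L).compDer d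
  let φ : L ⊗[S] Ω[S⁄K] →ₗ[L] L :=
    TensorProduct.AlgebraTensorModule.lift
      ((LinearMap.lsmul L (Ω[S⁄K] →ₗ[S] L)).flip d'.liftKaehlerDifferential)
  let ψ := φ ∘ₗ (tensorKaehlerEquivOfFormallyEtale K S L).symm.toLinearMap
  have hψ (i : ι) : ψ (D K L (x i)) = if i = j then 1 else 0 := by
    have hxi : x i = algebraMap S L (e (MvPolynomial.X i)) := by
      simp [e, AlgebraicIndependent.aevalEquiv, S]
    have : ψ (D K L (x i)) = d' (e (MvPolynomial.X i)) := by
      rw [hxi]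
      simp only [ψ, LinearMap.comp_apply, LinearEquiv.coe_coe]
      rw [tensorKaehlerEquivOfFormallyEtale_symm_D_algebraMap]
      simp [φ]
    rw [this]
    have hd : d (e (MvPolynomial.X i)) = e (d₀ (MvPolynomial.X i)) := by
      change e (d₀ (e.symm (e (MvPolynomial.X i)))) = _
      rw [e.symm_apply_apply]
    change algebraMap S L (d (e (MvPolynomial.X i))) = _
    rw [hd]
    simp only [d₀, MvPolynomial.pderiv_X, Pi.single_apply]
    split_ifs <;> simp
  have := congrArg ψ hc
  simpa [hψ, hj] using this

theorem _root_.AlgebraicIndependent.linearIndependent_D {K L ι : Type*} [Field K] [Field L]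
    [Algebra K L] [CharZero K] {x : ι → L} (hx : AlgebraicIndependent K x) :
    LinearIndependent L (fun i => D K L (x i)) := by
  obtain ⟨t, ht, hb⟩ := exists_isTranscendenceBasis_superset (AlgebraicIndependent.coe_range hx)
  exact hb.linearIndependent_D.comp (fun i => (⟨x i, ht ⟨i, rfl⟩⟩ : t))
    fun i j hij => AlgebraicIndependent.injective hx (congrArg Subtype.val hij)

theorem D_mem_span_of_isAlgebraic {K L : Type*} [Field K] [Field L] [Algebra K L] [CharZero K]
    {s : Set L} {a : L} (ha : IsAlgebraic (Algebra.adjoin K s) a) :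
    D K L a ∈ Submodule.span L (D K L '' s) := by
  set N := Submodule.span L (D K L '' s)
  let d : Derivation K L (Ω[L⁄K] ⧸ N) := N.mkQ.compDer (D K L)
  have hd : Set.EqOn d (0 : Derivation K L (Ω[L⁄K] ⧸ N)) (Algebra.adjoin K s) := by
    apply Derivation.eqOn_adjoin
    intro b hb
    simpa [d] using Submodule.subset_span (Set.mem_image_of_mem _ hb)
  let d' : Derivation (Algebra.adjoin K s) L (Ω[L⁄K] ⧸ N) :=
    { toFun := d
      map_add' := d.map_add
      map_smul' := by
        intro r b
        have := hd r.2
        simp only [Derivation.zero_apply] at this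
        simp [Algebra.smul_def, d.leibniz]
        rw [this]
        simp
        rfl
      map_one_eq_zero' := by simp
      leibniz' := by simp }
  have hmin : ∃ p : Polynomial (Algebra.adjoin K s), p ≠ 0 ∧ Polynomial.aeval a p = 0 := ha
  obtain ⟨p, ⟨hp0, hp⟩, hpm⟩ := WellFounded.has_min
    (InvImage.wf Polynomial.natDegree Nat.lt_wfRel.wf) {p | p ≠ 0 ∧ Polynomial.aeval a p = 0} hmin
  have hdeg : p.natDegree ≠ 0 := by
    intro h0
    rw [Polynomial.eq_C_of_natDegree_eq_zero h0] at hp hp0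
    simp at hp hp0
    exact hp0 hp
  have hder : Polynomial.aeval a (Polynomial.derivative p) ≠ 0 := by
    intro h0
    refine hpm _ ⟨?_, h0⟩ (Polynomial.natDegree_derivative_lt hdeg)
    intro h1
    have : CharZero (Algebra.adjoin K s) :=
      charZero_of_injective_algebraMap (algebraMap K (Algebra.adjoin K s)).injective
    exact hdeg (Polynomial.derivative_eq_zero.mp h1)
  have h := Derivation.map_aeval d' p a
  rw [hp, map_zero] at h
  have h2 : d a = 0 := (smul_eq_zero.mp h.symm).resolve_left hder
  exact (Submodule.Quotient.mk_eq_zero N).mp h2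

theorem _root_.AlgebraicIndependent.of_linearIndependent_D {K L ι : Type*} [Field K] [Field L]
    [Algebra K L] [CharZero K] {x : ι → L} (h : LinearIndependent L (fun i => D K L (x i))) :
    AlgebraicIndependent K x := by
  apply algebraicIndependent_of_finite_type' (algebraMap K L).injective
  intro t _ _ i hi hia
  have := D_mem_span_of_isAlgebraic hia
  rw [Set.image_image] at this
  refine (linearIndependent_iff_notMem_span.mp h i)
    (Submodule.span_mono (Set.image_mono fun j hj => ?_) this)
  simp only [Set.mem_sdiff, Set.mem_univ, Set.mem_singleton_iff, true_and]
  rintro rfl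
  exact hi hj

end Differentials

section Gradients
open KaehlerDifferential Filter Topology MvPolynomial

variable {σ κ : Type*} [Fintype σ]

/-- The gradient at `q` of a polynomial with rational coefficients. -/
def grad (q : σ → ℝ) (F : MvPolynomial σ ℚ) : σ → ℝ := fun i => aeval q (pderiv i F)

theorem D_aeval_eq_linearCombination (q : σ → ℝ) (F : MvPolynomial σ ℚ) :
    D ℚ ℝ (aeval q F) = Fintype.linearCombination ℝ (fun i => D ℚ ℝ (q i)) (grad q F) := by
  classical
  simp only [Fintype.linearCombination_apply, grad]
  induction F using MvPolynomial.induction_on with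
  | C a => simpa using (D ℚ ℝ).map_algebraMap a
  | add P Q hP hQ => simp [hP, hQ, add_smul, Finset.sum_add_distrib]
  | mul_X P j hP =>
    simp only [map_mul, aeval_X, Derivation.leibniz, hP, smul_eq_mul, pderiv_X, map_add, add_smul,
      Finset.sum_add_distrib, Finset.smul_sum, mul_smul]
    congr 1
    rw [Finset.sum_eq_single j]
    · simp
    · intro b _ hb
      simp [hb.symm]
    · simp

theorem hasStrictFDerivAt_aeval (q : σ → ℝ) (F : MvPolynomial σ ℚ) :
    HasStrictFDerivAt (fun q : σ → ℝ => aeval q F)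
      (∑ i, grad q F i • (ContinuousLinearMap.proj i : (σ → ℝ) →L[ℝ] ℝ)) q := by
  classical
  simp only [grad]
  induction F using MvPolynomial.induction_on with
  | C a => simpa using hasStrictFDerivAt_const _ _
  | add P Q hP hQ =>
    simp only [map_add, add_smul, Finset.sum_add_distrib]
    exact hP.add hQ
  | mul_X P j hP =>
    have h := hP.mul
      ((ContinuousLinearMap.proj (R := ℝ) (φ := fun _ : σ => ℝ) j).hasStrictFDerivAt (x := q))
    simp only [map_mul, aeval_X]
    refine h.congr_fderiv ?_
    ext v
    simp [pderiv_X, Pi.single_apply, add_mul, Finset.sum_add_distrib, Finset.mul_sum, apply_ite,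
      mul_assoc]

theorem continuous_aeval (F : MvPolynomial σ ℚ) : Continuous fun q : σ → ℝ => aeval q F :=
  continuous_iff_continuousAt.mpr fun q => (hasStrictFDerivAt_aeval q F).hasFDerivAt.continuousAt

theorem algebraicIndependent_aeval {q : σ → ℝ} (hq : AlgebraicIndependent ℚ q)
    {F : κ → MvPolynomial σ ℚ} (h : LinearIndependent ℝ fun k => grad q (F k)) :
    AlgebraicIndependent ℚ fun k => aeval q (F k) := by
  apply AlgebraicIndependent.of_linearIndependent_D
  simp only [D_aeval_eq_linearCombination]
  exact h.map' (Fintype.linearCombination ℝ (fun i => D ℚ ℝ (q i)))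
    (LinearMap.ker_eq_bot.mpr
      (linearIndependent_iff_injective_fintypeLinearCombination.mp
        (AlgebraicIndependent.linearIndependent_D hq)))

theorem linearIndependent_grad {q : σ → ℝ} {F : κ → MvPolynomial σ ℚ}
    (h : AlgebraicIndependent ℚ fun k => aeval q (F k)) :
    LinearIndependent ℝ fun k => grad q (F k) := by
  have := AlgebraicIndependent.linearIndependent_D h
  simp only [D_aeval_eq_linearCombination] at this
  exact LinearIndependent.of_comp (Fintype.linearCombination ℝ (fun i => D ℚ ℝ (q i))) this

theorem algebraicIndependent_of_linearIndependent_grad {q : σ → ℝ} (hq : AlgebraicIndependent ℚ q)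
    {F : κ → MvPolynomial σ ℚ} (h : LinearIndependent ℝ fun k => grad q (F k)) :
    AlgebraicIndependent ℚ F :=
  AlgebraicIndependent.of_comp (aeval q) (algebraicIndependent_aeval hq h)

theorem linearIndependent_grad_of_generic {p q : σ → ℝ} (hp : AlgebraicIndependent ℚ p)
    (hq : AlgebraicIndependent ℚ q) {F : κ → MvPolynomial σ ℚ}
    (h : LinearIndependent ℝ fun k => grad p (F k)) : LinearIndependent ℝ fun k => grad q (F k) :=
  linearIndependent_grad
    ((algebraicIndependent_of_linearIndependent_grad hp h).map' (f := aeval q) hq)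

/-- A polynomial whose gradient at a generic point depends on those of an independent family takes
only finitely many values on each generic fibre of the family. -/
theorem exists_finite_values_on_fibre {p : σ → ℝ} (hp : AlgebraicIndependent ℚ p)
    {F : κ → MvPolynomial σ ℚ} (h : LinearIndependent ℝ fun k => grad p (F k))
    {P : MvPolynomial σ ℚ}
    (hP : grad p P ∈ Submodule.span ℝ (Set.range fun k => grad p (F k))) :
    ∃ S : Set ℝ, S.Finite ∧ ∀ q : σ → ℝ, (∀ k, aeval q (F k) = aeval p (F k)) → aeval q P ∈ S := by
  have hF := algebraicIndependent_of_linearIndependent_grad hp h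
  have hnot : ¬ AlgebraicIndependent ℚ (fun o : Option κ => o.elim P F) := by
    intro hc
    have h1 := linearIndependent_grad (hc.map' (f := aeval p) hp)
    have h2 := linearIndependent_iff_notMem_span.mp h1 none
    apply h2
    refine Submodule.span_mono ?_ hP
    rintro _ ⟨k, rfl⟩
    exact ⟨some k, by simp, rfl⟩
  rw [AlgebraicIndependent.option_iff, not_and] at hnot
  obtain ⟨g, hg0, hg⟩ : IsAlgebraic (Algebra.adjoin ℚ (Set.range F)) P := by
    have := hnot hF
    rwa [Transcendental, not_not] at this
  let φ (q : σ → ℝ) : Algebra.adjoin ℚ (Set.range F) →ₐ[ℚ] ℝ :=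
    (aeval q).comp (Algebra.adjoin ℚ (Set.range F)).val
  let r : Polynomial ℝ := g.map (φ p).toRingHom
  have hr : r ≠ 0 := by
    rw [Ne, Polynomial.map_eq_zero_iff]
    · exact hg0
    · exact Function.Injective.comp (g := aeval p) hp Subtype.val_injective
  refine ⟨r.rootSet ℝ, r.rootSet_finite ℝ, fun q hq => ?_⟩
  have hφ : φ q = φ p := by
    apply AlgHom.adjoin_ext
    rintro _ ⟨k, rfl⟩
    exact hq k
  rw [Polynomial.mem_rootSet]
  refine ⟨hr, ?_⟩
  have := congrArg (aeval q) hg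
  rw [map_zero, Polynomial.aeval_def, ← AlgHom.coe_toRingHom, Polynomial.hom_eval₂] at this
  simp only [r, ← hφ]
  rw [Polynomial.aeval_def, Polynomial.eval₂_map]
  exact this

theorem eventually_eq_on_fibre {p : σ → ℝ} (hp : AlgebraicIndependent ℚ p)
    {F : κ → MvPolynomial σ ℚ} (h : LinearIndependent ℝ fun k => grad p (F k))
    {P : MvPolynomial σ ℚ}
    (hP : grad p P ∈ Submodule.span ℝ (Set.range fun k => grad p (F k))) (q : σ → ℝ) :
    ∀ᶠ q' in 𝓝 q, (∀ k, aeval q' (F k) = aeval p (F k)) → aeval q' P = aeval q P := by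
  obtain ⟨S, hS, hval⟩ := exists_finite_values_on_fibre hp h hP
  have hopen : IsOpen (S \ {aeval q P})ᶜ := (hS.subset Set.sdiff_subset).isClosed.isOpen_compl
  have hev : ∀ᶠ q' : σ → ℝ in 𝓝 q, aeval q' P ∈ (S \ {aeval q P})ᶜ :=
    (continuous_aeval P).continuousAt.eventually (hopen.mem_nhds (by simp))
  filter_upwards [hev] with q' hq' hfib
  by_contra hne
  exact hq' ⟨hval q' hfib, hne⟩

end Gradients

section LocalFibres
open KaehlerDifferential Filter Topology MvPolynomial

theorem countable_adjoin {s : Set ℝ} (hs : s.Countable) : Countable (Algebra.adjoin ℚ s) := by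
  have := hs.to_subtype
  have : Countable (MvPolynomial s ℚ) :=
    Cardinal.mk_le_aleph0_iff.mp (MvPolynomial.cardinalMk_le_max.trans (by simp))
  have h : ((Algebra.adjoin ℚ s : Subalgebra ℚ ℝ) : Set ℝ) =
      Set.range (aeval (R := ℚ) (Subtype.val : s → ℝ)) := by
    rw [Algebra.adjoin_eq_range]
    rfl
  exact (h ▸ Set.countable_range _ : ((Algebra.adjoin ℚ s : Subalgebra ℚ ℝ) : Set ℝ).Countable)

theorem exists_update_algebraicIndepOn {B : Type*} [DecidableEq B] {x : B → ℝ} {S : Set B}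
    (hS : S.Countable) (hx : AlgebraicIndepOn ℚ x S) {i : B} (hi : i ∉ S) {U : Set (B → ℝ)}
    (hU : U ∈ 𝓝 x) :
    ∃ t : ℝ, Function.update x i t ∈ U ∧
      AlgebraicIndepOn ℚ (Function.update x i t) (insert i S) := by
  have hc : Continuous fun t : ℝ => Function.update x i t := by fun_prop
  have hmem : (fun t : ℝ => Function.update x i t) ⁻¹' U ∈ 𝓝 (x i) := by
    apply hc.continuousAt.preimage_mem_nhds
    simpa using hU
  have : Countable (x '' S) := (hS.image x).to_subtype
  have hcount : Countable (Algebra.adjoin ℚ (x '' S)) :=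
    countable_adjoin (hS.image x)
  have halg : {t : ℝ | IsAlgebraic (Algebra.adjoin ℚ (x '' S)) t}.Countable :=
    Algebraic.countable _ _
  obtain ⟨t, ht, htU⟩ := (halg.dense_compl ℝ).inter_nhds_nonempty hmem
  refine ⟨t, htU, ?_⟩
  have heq : Set.EqOn (Function.update x i t) x S := fun j hj =>
    Function.update_of_ne (fun h : j = i => hi (h ▸ hj)) _ _
  apply AlgebraicIndepOn.insert
  · have h2 : (fun j : S => Function.update x i t j) = fun j : S => x j := funext fun j => heq j.2
    rw [AlgebraicIndepOn, h2]
    exact hx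
  · rw [Function.update_self, heq.image_eq]
    exact ht

/-- Coordinates may be perturbed so as to become algebraically independent, keeping fixed a
subfamily that already is. -/
theorem exists_algebraicIndependent_mem_nhds {B : Type*} [Finite B] {x : B → ℝ} {S : Set B}
    (hx : AlgebraicIndepOn ℚ x S) {U : Set (B → ℝ)} (hU : U ∈ 𝓝 x) :
    ∃ x' ∈ U, (∀ b ∈ S, x' b = x b) ∧ AlgebraicIndependent ℚ x' := by
  classical
  have := Fintype.ofFinite B
  obtain ⟨W, hWU, hWo, hxW⟩ := mem_nhds_iff.mp hU
  have key : ∀ T : Finset B, ∃ x' ∈ W, (∀ b ∈ S, x' b = x b) ∧ AlgebraicIndepOn ℚ x' (S ∪ T) := by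
    intro T
    induction T using Finset.induction_on with
    | empty => exact ⟨x, hxW, fun _ _ => rfl, by simpa using hx⟩
    | insert i T _ ih =>
      obtain ⟨x', hx'W, hx'S, hx'⟩ := ih
      by_cases hi : i ∈ S ∪ T
      · refine ⟨x', hx'W, hx'S, ?_⟩
        rwa [Finset.coe_insert, Set.union_insert, Set.insert_eq_of_mem hi]
      · obtain ⟨t, htW, ht⟩ := exists_update_algebraicIndepOn (Set.to_countable _) hx' hi
          (hWo.mem_nhds hx'W)
        refine ⟨_, htW, fun b hb => ?_, ?_⟩
        · rw [Function.update_of_ne, hx'S b hb]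
          rintro rfl
          exact hi (Or.inl hb)
        · rwa [Finset.coe_insert, Set.union_insert]
  obtain ⟨x', hx'W, hx'S, hx'⟩ := key Finset.univ
  refine ⟨x', hWU hx'W, hx'S, ?_⟩
  rw [Finset.coe_univ, Set.union_univ] at hx'
  exact hx'.comp (fun b => ⟨b, trivial⟩) fun a b h => congrArg Subtype.val h

theorem exists_generic_mem_nhds {B : Type*} [Finite B] {x : B → ℝ} {U : Set (B → ℝ)}
    (hU : U ∈ 𝓝 x) : ∃ x' ∈ U, AlgebraicIndependent ℚ x' := by
  obtain ⟨x', h, -, h'⟩ := exists_algebraicIndependent_mem_nhds (x := x) (S := ∅)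
    ((algebraicIndependent_empty_type_iff).mpr (algebraMap ℚ ℝ).injective) hU
  exact ⟨x', h, h'⟩

variable {σ κ : Type*} [Fintype σ] [Fintype κ]

/-- The derivative at `q` of the map with components `F`. -/
def gradMap (F : κ → MvPolynomial σ ℚ) (q : σ → ℝ) : (σ → ℝ) →L[ℝ] (κ → ℝ) :=
  ContinuousLinearMap.pi fun k =>
    ∑ i, grad q (F k) i • (ContinuousLinearMap.proj i : (σ → ℝ) →L[ℝ] ℝ)

omit [Fintype κ] in
theorem hasStrictFDerivAt_gradMap (F : κ → MvPolynomial σ ℚ) (q : σ → ℝ) :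
    HasStrictFDerivAt (fun (q : σ → ℝ) k => aeval q (F k)) (gradMap F q) q :=
  hasStrictFDerivAt_pi.mpr fun k => hasStrictFDerivAt_aeval q (F k)

theorem range_gradMap {F : κ → MvPolynomial σ ℚ} {q : σ → ℝ}
    (h : LinearIndependent ℝ fun k => grad q (F k)) :
    (gradMap F q : (σ → ℝ) →ₗ[ℝ] (κ → ℝ)).range = ⊤ := by
  classical
  rw [LinearMap.range_eq_top, ← LinearMap.dualMap_injective_iff, ← LinearMap.ker_eq_bot,
    LinearMap.ker_eq_bot']
  intro φ hφ
  rw [Fintype.linearIndependent_iff] at h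
  have h0 : ∀ k, φ (Pi.single k 1) = 0 := by
    apply h
    ext i
    have := congrArg (fun ψ => ψ (Pi.single i 1)) hφ
    simp only [LinearMap.dualMap_apply, LinearMap.zero_apply] at this
    rw [LinearMap.pi_apply_eq_sum_univ φ] at this
    rw [Pi.zero_apply, ← this]
    simp only [Finset.sum_apply, Pi.smul_apply, smul_eq_mul]
    refine Finset.sum_congr rfl fun k _ => ?_
    have h1 : (fun j => if k = j then 1 else 0) = (Pi.single k 1 : κ → ℝ) := by
      ext j
      simp [Pi.single_apply, eq_comm]
    rw [h1, mul_comm]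
    simp [gradMap, Pi.single_apply]
  apply LinearMap.pi_ext'
  intro k
  ext
  simpa using h0 k

theorem map_nhds_aeval {F : κ → MvPolynomial σ ℚ} {q : σ → ℝ}
    (h : LinearIndependent ℝ fun k => grad q (F k)) :
    Filter.map (fun (q : σ → ℝ) k => aeval q (F k)) (𝓝 q) = 𝓝 fun k => aeval q (F k) :=
  (hasStrictFDerivAt_gradMap F q).map_nhds_eq_of_surj (range_gradMap h)

/-- A regular point of a polynomial map admits a local section through it. -/
theorem exists_local_section {F : κ → MvPolynomial σ ℚ} {q : σ → ℝ}
    (h : LinearIndependent ℝ fun k => grad q (F k)) :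
    ∃ g : (κ → ℝ) → σ → ℝ, g (fun k => aeval q (F k)) = q ∧
      ∀ᶠ y in 𝓝 fun k => aeval q (F k), ContinuousAt g y ∧ ∀ k, aeval (g y) (F k) = y k := by
  let Φ := (hasStrictFDerivAt_gradMap F q).implicitToOpenPartialHomeomorph _ _ (range_gradMap h)
  have hq : q ∈ Φ.source :=
    (hasStrictFDerivAt_gradMap F q).mem_implicitToOpenPartialHomeomorph_source (range_gradMap h)
  have hΦq : Φ q = (fun k => aeval q (F k), 0) :=
    (hasStrictFDerivAt_gradMap F q).implicitToOpenPartialHomeomorph_self (range_gradMap h)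
  have hfst (z : σ → ℝ) : (Φ z).1 = fun k => aeval z (F k) :=
    (hasStrictFDerivAt_gradMap F q).implicitToOpenPartialHomeomorph_fst (range_gradMap h) z
  have htar : (fun k => aeval q (F k), 0) ∈ Φ.target := hΦq ▸ Φ.map_source hq
  refine ⟨fun y => Φ.symm (y, 0), ?_, ?_⟩
  · simp only
    rw [← hΦq, Φ.left_inv hq]
  · have hc : Continuous fun y : κ → ℝ =>
        ((y, 0) : (κ → ℝ) × (gradMap F q : (σ → ℝ) →ₗ[ℝ] (κ → ℝ)).ker) := by fun_prop
    filter_upwards [hc.continuousAt.preimage_mem_nhds (Φ.open_target.mem_nhds htar)] with y hy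
    refine ⟨ContinuousAt.comp (f := fun y : κ → ℝ => (y, 0)) (Φ.continuousAt_symm hy)
      hc.continuousAt, fun k => ?_⟩
    have := hfst (Φ.symm (y, 0))
    rw [Φ.right_inv hy] at this
    exact (congrFun this k).symm

/-- Near a regular point the `c`-th component can be increased along a path, while all the others
are kept fixed. -/
theorem exists_path [DecidableEq κ] {F : κ → MvPolynomial σ ℚ} {q : σ → ℝ}
    (h : LinearIndependent ℝ fun k => grad q (F k)) (c : κ) {U : Set (σ → ℝ)} (hU : U ∈ 𝓝 q) :
    ∃ ε > 0, ∃ γ : ℝ → σ → ℝ, ContinuousOn γ (Set.Icc 0 ε) ∧ γ 0 = q ∧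
      ∀ s ∈ Set.Icc 0 ε, γ s ∈ U ∧
        ∀ k, aeval (γ s) (F k) = aeval q (F k) + if k = c then s else 0 := by
  obtain ⟨g, hg0, hg⟩ := exists_local_section h
  let y : ℝ → κ → ℝ := fun s k => aeval q (F k) + if k = c then s else 0
  have hy : Continuous y := by
    refine continuous_pi fun k => ?_
    refine continuous_const.add ?_
    by_cases hk : k = c
    · simpa only [hk, if_true] using continuous_id'
    · simpa only [hk, if_false] using continuous_const
  have hy0 : y 0 = fun k => aeval q (F k) := by ext; simp [y]
  have hev : ∀ᶠ s in 𝓝 (0 : ℝ), (ContinuousAt g (y s) ∧ ∀ k, aeval (g (y s)) (F k) = y s k) ∧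
      g (y s) ∈ U := by
    rw [← hy0] at hg
    have hgc : ContinuousAt (fun s => g (y s)) 0 := hg.self_of_nhds.1.comp hy.continuousAt
    refine (hy.continuousAt.eventually hg).and (hgc.eventually ?_)
    have : U ∈ 𝓝 (g (y 0)) := by rwa [hy0, hg0]
    exact this
  obtain ⟨ε, hε, hball⟩ := Metric.eventually_nhds_iff_ball.mp hev
  have hIcc : ∀ s ∈ Set.Icc 0 (ε / 2), s ∈ Metric.ball (0 : ℝ) ε := by
    intro s hs
    rw [Metric.mem_ball, Real.dist_eq, sub_zero, abs_of_nonneg hs.1]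
    linarith [hs.2]
  refine ⟨ε / 2, half_pos hε, fun s => g (y s), ?_, ?_, ?_⟩
  · intro s hs
    exact ((hball s (hIcc s hs)).1.1.comp hy.continuousAt).continuousWithinAt
  · simp only [hy0, hg0]
  · intro s hs
    exact ⟨(hball s (hIcc s hs)).2, (hball s (hIcc s hs)).1.2⟩

end LocalFibres

section GenericFibres
open KaehlerDifferential Filter Topology MvPolynomial

variable {σ κ : Type*} [Fintype σ] [Fintype κ]

omit [Fintype σ] in
theorem grad_X [DecidableEq σ] (q : σ → ℝ) (j : σ) :
    grad q (X j) = Pi.single j 1 := by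
  ext i
  by_cases h : i = j
  · subst h
    simp [grad]
  · simp [grad, pderiv_X, h, Ne.symm h]

theorem algebraicIndependent_of_basis_grad {q : σ → ℝ} {F : κ → MvPolynomial σ ℚ}
    (hcard : Fintype.card σ ≤ Fintype.card κ)
    (h : AlgebraicIndependent ℚ fun k => aeval q (F k)) : AlgebraicIndependent ℚ q := by
  apply AlgebraicIndependent.of_linearIndependent_D
  rw [linearIndependent_iff_card_le_finrank_span]
  have hLI := AlgebraicIndependent.linearIndependent_D h
  have hle : Submodule.span ℝ (Set.range fun k => D ℚ ℝ (aeval q (F k))) ≤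
      Submodule.span ℝ (Set.range fun i => D ℚ ℝ (q i)) := by
    rw [Submodule.span_le]
    rintro _ ⟨k, rfl⟩
    simp only [D_aeval_eq_linearCombination, Fintype.linearCombination_apply]
    exact Submodule.sum_mem _ fun i _ =>
      Submodule.smul_mem _ _ (Submodule.subset_span ⟨i, rfl⟩)
  have : Module.Finite ℝ (Submodule.span ℝ (Set.range fun i => D ℚ ℝ (q i))) :=
    FiniteDimensional.span_of_finite ℝ (Set.finite_range _)
  calc Fintype.card σ ≤ Fintype.card κ := hcard
    _ = Module.finrank ℝ (Submodule.span ℝ (Set.range fun k => D ℚ ℝ (aeval q (F k)))) :=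
      (finrank_span_eq_card hLI).symm
    _ ≤ _ := Submodule.finrank_mono hle

/-- Generic points are dense in the fibre of an independent family through a generic point. -/
theorem exists_generic_on_fibre {p q : σ → ℝ} (hp : AlgebraicIndependent ℚ p)
    {F : κ → MvPolynomial σ ℚ} (h : LinearIndependent ℝ fun k => grad p (F k))
    (hq : ∀ k, aeval q (F k) = aeval p (F k)) {U : Set (σ → ℝ)} (hU : U ∈ 𝓝 q) :
    ∃ q' ∈ U, (∀ k, aeval q' (F k) = aeval p (F k)) ∧ AlgebraicIndependent ℚ q' := by
  classical
  have hai : AlgebraicIndependent ℚ fun k => aeval q (F k) := by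
    simpa only [hq] using algebraicIndependent_aeval hp h
  let P : κ ⊕ σ → MvPolynomial σ ℚ := Sum.elim F X
  have hs : LinearIndepOn ℝ (fun k => grad q (P k)) (Set.range Sum.inl) :=
    (linearIndepOn_range_iff Sum.inl_injective _).mpr (linearIndependent_grad hai)
  let T := hs.extend (Set.subset_univ _)
  have hT : LinearIndepOn ℝ (fun k => grad q (P k)) T := hs.linearIndepOn_extend _
  have hsub : Set.range Sum.inl ⊆ T := hs.subset_extend _
  have hcard : Fintype.card σ ≤ Fintype.card T := by
    have hspan : (⊤ : Submodule ℝ (σ → ℝ)) ≤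
        Submodule.span ℝ (Set.range fun k : T => grad q (P k)) := by
      rw [← (Pi.basisFun ℝ σ).span_eq, Submodule.span_le]
      rintro _ ⟨j, rfl⟩
      have := hs.image_subset_span_image_extend (Set.subset_univ _)
        (Set.mem_image_of_mem (fun k => grad q (P k)) (Set.mem_univ (Sum.inr j)))
      rw [Set.image_eq_range] at this
      simpa [P, grad_X] using this
    have := finrank_span_eq_card hT
    rw [top_le_iff.mp hspan, finrank_top, Module.finrank_fintype_fun_eq_card] at this
    exact this.le
  have hmap := map_nhds_aeval hT
  have himage : (fun (q : σ → ℝ) (k : T) => aeval q (P k)) '' U ∈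
      𝓝 fun k : T => aeval q (P k) := hmap ▸ image_mem_map hU
  have hS : AlgebraicIndepOn ℚ (fun k : T => aeval q (P k))
      {k : T | (k : κ ⊕ σ) ∈ Set.range Sum.inl} := by
    have hc : ∀ k : {k : T | (k : κ ⊕ σ) ∈ Set.range Sum.inl}, ∃ j, Sum.inl j = (k : κ ⊕ σ) :=
      fun k => k.2
    choose f hf using hc
    have := hai.comp f fun a b hab => by
      apply Subtype.ext
      apply Subtype.ext
      rw [← hf a, ← hf b, hab]
    convert this using 2 with k
    simp [P, ← hf k]
  obtain ⟨_, ⟨q', hq'U, rfl⟩, hq'S, hq'⟩ := exists_algebraicIndependent_mem_nhds hS himage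
  refine ⟨q', hq'U, fun k => ?_, algebraicIndependent_of_basis_grad hcard hq'⟩
  have := hq'S ⟨Sum.inl k, hsub ⟨k, rfl⟩⟩ ⟨k, rfl⟩
  simpa [P, hq] using this

end GenericFibres

section GenericBasis
open Filter Topology MvPolynomial

variable {σ κ : Type*} [Fintype σ]

theorem mem_span_grad_of_generic {p q : σ → ℝ} (hp : AlgebraicIndependent ℚ p)
    (hq : AlgebraicIndependent ℚ q) {F : κ → MvPolynomial σ ℚ}
    (h : LinearIndependent ℝ fun k => grad p (F k)) {P : MvPolynomial σ ℚ}
    (hP : grad p P ∈ Submodule.span ℝ (Set.range fun k => grad p (F k))) :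
    grad q P ∈ Submodule.span ℝ (Set.range fun k => grad q (F k)) := by
  by_contra hn
  have h1 : LinearIndependent ℝ fun o : Option κ => grad q (o.elim P F) :=
    linearIndependent_option.mpr ⟨linearIndependent_grad_of_generic hp hq h, hn⟩
  exact (linearIndependent_option.mp (linearIndependent_grad_of_generic hq hp h1)).2 hP

/-- A subfamily which is, at every generic point, a maximal independent one. -/
theorem exists_generic_basis (F : κ → MvPolynomial σ ℚ) :
    ∃ I : Set κ, ∀ q : σ → ℝ, AlgebraicIndependent ℚ q →
      (LinearIndependent ℝ fun k : I => grad q (F k)) ∧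
        ∀ k, grad q (F k) ∈ Submodule.span ℝ (Set.range fun k : I => grad q (F k)) := by
  obtain ⟨p, -, hp⟩ := exists_generic_mem_nhds (x := (0 : σ → ℝ)) univ_mem
  have h0 : LinearIndepOn ℝ (fun k => grad p (F k)) ∅ := linearIndepOn_empty ℝ _
  let I := h0.extend (Set.subset_univ _)
  have hI : LinearIndependent ℝ fun k : I => grad p (F k) := h0.linearIndepOn_extend _
  have hspan (k : κ) : grad p (F k) ∈ Submodule.span ℝ (Set.range fun k : I => grad p (F k)) := by
    have := h0.image_subset_span_image_extend (Set.subset_univ _)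
      (Set.mem_image_of_mem (fun k => grad p (F k)) (Set.mem_univ k))
    rwa [Set.image_eq_range] at this
  exact ⟨I, fun q hq => ⟨linearIndependent_grad_of_generic hp hq hI,
    fun k => mem_span_grad_of_generic hp hq hI (hspan k)⟩⟩

omit [Fintype σ] in
theorem span_range_grad_eq {q : σ → ℝ} {F : κ → MvPolynomial σ ℚ} {I : Set κ}
    (h : ∀ k, grad q (F k) ∈ Submodule.span ℝ (Set.range fun k : I => grad q (F k))) :
    Submodule.span ℝ (Set.range fun k => grad q (F k)) =
      Submodule.span ℝ (Set.range fun k : I => grad q (F k)) := by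
  apply le_antisymm
  · rw [Submodule.span_le]
    rintro _ ⟨k, rfl⟩
    exact h k
  · apply Submodule.span_mono
    rintro _ ⟨k, rfl⟩
    exact ⟨k, rfl⟩

theorem mem_span_grad_iff_of_generic {p q : σ → ℝ} (hp : AlgebraicIndependent ℚ p)
    (hq : AlgebraicIndependent ℚ q) (F : κ → MvPolynomial σ ℚ) (P : MvPolynomial σ ℚ) :
    grad p P ∈ Submodule.span ℝ (Set.range fun k => grad p (F k)) ↔
      grad q P ∈ Submodule.span ℝ (Set.range fun k => grad q (F k)) := by
  obtain ⟨I, hI⟩ := exists_generic_basis F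
  rw [span_range_grad_eq (hI p hp).2, span_range_grad_eq (hI q hq).2]
  exact ⟨mem_span_grad_of_generic hp hq (hI p hp).1, mem_span_grad_of_generic hq hp (hI q hq).1⟩

variable [Fintype κ]

/-- Generic points are dense in every fibre through a generic point. -/
theorem exists_generic_mem_fibre {p q : σ → ℝ} (hp : AlgebraicIndependent ℚ p)
    {F : κ → MvPolynomial σ ℚ} (hq : ∀ k, aeval q (F k) = aeval p (F k)) {U : Set (σ → ℝ)}
    (hU : U ∈ 𝓝 q) :
    ∃ q' ∈ U, (∀ k, aeval q' (F k) = aeval p (F k)) ∧ AlgebraicIndependent ℚ q' := by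
  classical
  obtain ⟨I, hI⟩ := exists_generic_basis F
  have hev : ∀ᶠ q' in 𝓝 q, ∀ k, (∀ k : I, aeval q' (F k) = aeval p (F k)) →
      aeval q' (F k) = aeval q (F k) :=
    eventually_all.mpr fun k => eventually_eq_on_fibre hp (hI p hp).1 ((hI p hp).2 k) q
  obtain ⟨q', ⟨hq'U, hq'⟩, hfib, hgen⟩ :=
    exists_generic_on_fibre hp (hI p hp).1 (fun k => hq k) (inter_mem hU hev)
  exact ⟨q', hq'U, fun k => (hq' k hfib).trans (hq k), hgen⟩

/-- At a generic point, a polynomial whose gradient is independent of those of a family can be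
increased along a path inside the fibre of the family. -/
theorem exists_path_in_fibre {q : σ → ℝ} (hq : AlgebraicIndependent ℚ q)
    {F : κ → MvPolynomial σ ℚ} {P : MvPolynomial σ ℚ}
    (hP : grad q P ∉ Submodule.span ℝ (Set.range fun k => grad q (F k)))
    {U : Set (σ → ℝ)} (hU : U ∈ 𝓝 q) :
    ∃ ε > 0, ∃ γ : ℝ → σ → ℝ, ContinuousOn γ (Set.Icc 0 ε) ∧ γ 0 = q ∧
      ∀ s ∈ Set.Icc 0 ε, γ s ∈ U ∧ (∀ k, aeval (γ s) (F k) = aeval q (F k)) ∧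
        aeval (γ s) P = aeval q P + s := by
  classical
  obtain ⟨I, hI⟩ := exists_generic_basis F
  rw [span_range_grad_eq (hI q hq).2] at hP
  have hLI : LinearIndependent ℝ fun o : Option I => grad q (o.elim P fun k : I => F k) :=
    linearIndependent_option.mpr ⟨(hI q hq).1, hP⟩
  have hev : ∀ᶠ q' in 𝓝 q, ∀ k, (∀ k : I, aeval q' (F k) = aeval q (F k)) →
      aeval q' (F k) = aeval q (F k) :=
    eventually_all.mpr fun k => eventually_eq_on_fibre hq (hI q hq).1 ((hI q hq).2 k) q
  obtain ⟨ε, hε, γ, hγ, hγ0, h⟩ := exists_path hLI none (inter_mem hU hev)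
  refine ⟨ε, hε, γ, hγ, hγ0, fun s hs => ⟨(h s hs).1.1, fun k => ?_, ?_⟩⟩
  · exact (h s hs).1.2 k fun k => by simpa using (h s hs).2 (some k)
  · simpa using (h s hs).2 none

end GenericBasis

section Lengths
open Filter Topology MvPolynomial

variable {W : Type*} [Fintype W] [DecidableEq W] {d : ℕ}

/-- Squared Euclidean distance. -/
def sqDist (a b : Fin d → ℝ) : ℝ := ∑ i, (a i - b i) ^ 2

theorem sqDist_nonneg (a b : Fin d → ℝ) : 0 ≤ sqDist a b :=
  Finset.sum_nonneg fun _ _ => sq_nonneg _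

theorem sqDist_comm (a b : Fin d → ℝ) : sqDist a b = sqDist b a :=
  Finset.sum_congr rfl fun _ _ => by ring

theorem eDist_eq_iff {a b a' b' : Fin d → ℝ} :
    eDist a b = eDist a' b' ↔ sqDist a b = sqDist a' b' :=
  Real.sqrt_inj (sqDist_nonneg a b) (sqDist_nonneg a' b')

/-- The polynomial giving the squared distance of the points of two vertices. -/
def lenPoly (d : ℕ) (e : W × W) : MvPolynomial (W × Fin d) ℚ :=
  ∑ i, (X (e.1, i) - X (e.2, i)) ^ 2

omit [Fintype W] [DecidableEq W] in
theorem aeval_lenPoly (q : W × Fin d → ℝ) (e : W × W) :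
    aeval q (lenPoly d e) = sqDist (Function.curry q e.1) (Function.curry q e.2) := by
  simp [lenPoly, sqDist]

omit [Fintype W] in
theorem grad_lenPoly (q : W × Fin d → ℝ) (e : W × W) :
    grad q (lenPoly d e) = (2 : ℝ) • edgeVec (Function.curry q) e.1 e.2 := by
  ext ⟨w, j⟩
  have h (a : W) : (∑ i, (q (e.1, i) - q (e.2, i)) *
      (Pi.single (M := fun _ => ℝ) (w, j) 1 (a, i))) =
        if w = a then q (e.1, j) - q (e.2, j) else 0 := by
    by_cases hw : w = a
    · subst hw
      rw [Finset.sum_eq_single j] <;> simp +contextual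
    · simp [hw, Ne.symm hw]
  have hsingle (b : W × Fin d) : aeval q (Pi.single (M := fun _ => MvPolynomial (W × Fin d) ℚ)
      (w, j) 1 b) = Pi.single (M := fun _ => ℝ) (w, j) 1 b := by
    by_cases hb : b = (w, j)
    · subst hb
      simp
    · simp [Pi.single_eq_of_ne hb]
  have hs : grad q (lenPoly d e) (w, j) =
      2 * ((∑ i, (q (e.1, i) - q (e.2, i)) * (Pi.single (M := fun _ => ℝ) (w, j) 1 (e.1, i))) -
        ∑ i, (q (e.1, i) - q (e.2, i)) * (Pi.single (M := fun _ => ℝ) (w, j) 1 (e.2, i))) := by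
    simp only [grad, lenPoly, map_sum, Derivation.leibniz_pow, map_sub, ← Finset.sum_sub_distrib,
      Finset.mul_sum, pderiv_X]
    refine Finset.sum_congr rfl fun i _ => ?_
    simp only [hsingle, smul_eq_mul, nsmul_eq_mul, map_mul, map_sub, aeval_X,
      Nat.add_one_sub_one, pow_one, Nat.cast_ofNat, map_ofNat (aeval q) 2]
    ring
  rw [hs, h, h]
  simp only [edgeVec, Pi.smul_apply, smul_eq_mul, Function.curry]
  split_ifs with h1 h2 <;> simp_all

/-- The span of the rows of the rigidity matrix indexed by `F`. -/
def rowSpan (p : W → Fin d → ℝ) (F : Set (Sym2 W)) : Submodule ℝ (W × Fin d → ℝ) :=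
  Submodule.span ℝ {x | ∃ u v : W, s(u, v) ∈ F ∧ x = edgeVec p u v}

/-- The family of the squared lengths of the edges of `H`. -/
def edgePoly (d : ℕ) (H : SimpleGraph W) (e : {e : W × W // H.Adj e.1 e.2}) :
    MvPolynomial (W × Fin d) ℚ := lenPoly d e.1

omit [Fintype W] in
theorem span_range_grad_edgePoly (p : W → Fin d → ℝ) (H : SimpleGraph W) :
    Submodule.span ℝ (Set.range fun e => grad (Function.uncurry p) (edgePoly d H e)) =
      rowSpan p H.edgeSet := by
  apply le_antisymm
  · rw [Submodule.span_le]
    rintro _ ⟨e, rfl⟩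
    simp only [edgePoly, grad_lenPoly, Function.curry_uncurry]
    exact Submodule.smul_mem _ _ (Submodule.subset_span ⟨e.1.1, e.1.2, e.2, rfl⟩)
  · rw [rowSpan, Submodule.span_le]
    rintro _ ⟨u, v, huv, rfl⟩
    have h : edgeVec p u v =
        (2 : ℝ)⁻¹ • grad (Function.uncurry p) (edgePoly d H ⟨(u, v), huv⟩) := by
      simp [edgePoly, grad_lenPoly]
    rw [h]
    exact Submodule.smul_mem _ _ (Submodule.subset_span ⟨_, rfl⟩)

omit [Fintype W] in
theorem grad_lenPoly_mem_iff (p : W → Fin d → ℝ) (N : Submodule ℝ (W × Fin d → ℝ)) (a b : W) :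
    grad (Function.uncurry p) (lenPoly d (a, b)) ∈ N ↔ edgeVec p a b ∈ N := by
  rw [grad_lenPoly, Function.curry_uncurry, N.smul_mem_iff two_ne_zero]

omit [Fintype W] [DecidableEq W] in
theorem equivalent_iff (H : SimpleGraph W) (p q : W → Fin d → ℝ) :
    Equivalent H p q ↔
      ∀ e, aeval (Function.uncurry q) (edgePoly d H e) =
        aeval (Function.uncurry p) (edgePoly d H e) := by
  simp only [edgePoly, aeval_lenPoly, Function.curry_uncurry, Equivalent, eDist_eq_iff]
  exact ⟨fun h e => (h _ _ e.2).symm, fun h u v huv => (h ⟨(u, v), huv⟩).symm⟩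

omit [Fintype W] [DecidableEq W] in
theorem continuous_curry : Continuous (Function.curry : (W × Fin d → ℝ) → W → Fin d → ℝ) := by
  unfold Function.curry
  fun_prop

theorem Generic.edgeVec_mem_rowSpan_iff {p q : W → Fin d → ℝ} (hp : Generic p) (hq : Generic q)
    (H : SimpleGraph W) (a b : W) :
    edgeVec p a b ∈ rowSpan p H.edgeSet ↔ edgeVec q a b ∈ rowSpan q H.edgeSet := by
  rw [← grad_lenPoly_mem_iff p, ← grad_lenPoly_mem_iff q, ← span_range_grad_edgePoly,
    ← span_range_grad_edgePoly]
  exact mem_span_grad_iff_of_generic hp hq _ _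

omit [DecidableEq W] in
theorem exists_generic_placement_mem_nhds {q : W → Fin d → ℝ} {U : Set (W → Fin d → ℝ)}
    (hU : U ∈ 𝓝 q) : ∃ q' ∈ U, Generic q' := by
  obtain ⟨c, hc, hgen⟩ := exists_generic_mem_nhds (x := Function.uncurry q)
    (continuous_curry.continuousAt.preimage_mem_nhds (by rwa [Function.curry_uncurry]))
  exact ⟨Function.curry c, hc, hgen⟩

omit [DecidableEq W] in
theorem Generic.exists_generic_equivalent {p q : W → Fin d → ℝ} (hp : Generic p)
    {H : SimpleGraph W} (hq : Equivalent H p q) {U : Set (W → Fin d → ℝ)} (hU : U ∈ 𝓝 q) :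
    ∃ q' ∈ U, Equivalent H p q' ∧ Generic q' := by
  classical
  rw [equivalent_iff] at hq
  obtain ⟨c, hc, heq, hgen⟩ := exists_generic_mem_fibre hp hq
    (continuous_curry.continuousAt.preimage_mem_nhds (by rwa [Function.curry_uncurry]))
  exact ⟨Function.curry c, hc, (equivalent_iff _ _ _).mpr (by rwa [Function.uncurry_curry]), hgen⟩

theorem Generic.exists_path_equivalent {q : W → Fin d → ℝ} (hq : Generic q)
    {H : SimpleGraph W} {a b : W} (hab : edgeVec q a b ∉ rowSpan q H.edgeSet)
    {U : Set (W → Fin d → ℝ)} (hU : U ∈ 𝓝 q) :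
    ∃ ε > 0, ∃ γ : ℝ → W → Fin d → ℝ, ContinuousOn γ (Set.Icc 0 ε) ∧ γ 0 = q ∧
      ∀ s ∈ Set.Icc 0 ε, γ s ∈ U ∧ Equivalent H q (γ s) ∧
        sqDist (γ s a) (γ s b) = sqDist (q a) (q b) + s := by
  classical
  rw [← grad_lenPoly_mem_iff q, ← span_range_grad_edgePoly] at hab
  obtain ⟨ε, hε, γ, hγ, hγ0, h⟩ := exists_path_in_fibre (q := Function.uncurry q) hq hab
    (continuous_curry.continuousAt.preimage_mem_nhds (by rwa [Function.curry_uncurry]))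
  refine ⟨ε, hε, fun s => Function.curry (γ s), continuous_curry.comp_continuousOn hγ,
    by simp only [hγ0, Function.curry_uncurry], fun s hs => ⟨(h s hs).1, ?_, ?_⟩⟩
  · rw [equivalent_iff, Function.uncurry_curry]
    exact (h s hs).2.1
  · simpa only [aeval_lenPoly, Function.curry_uncurry] using (h s hs).2.2

theorem GloballyLinked.edgeVec_mem_rowSpan {H : SimpleGraph W} {a b : W}
    (h : GloballyLinked d H a b) {p : W → Fin d → ℝ} (hp : Generic p) :
    edgeVec p a b ∈ rowSpan p H.edgeSet := by
  by_contra hab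
  obtain ⟨ε, hε, γ, -, -, hγ⟩ := hp.exists_path_equivalent hab univ_mem
  have h1 := hγ ε ⟨hε.le, le_rfl⟩
  have h2 := eDist_eq_iff.mp (h p hp _ h1.2.1)
  linarith [h1.2.2]

end Lengths

section Bridge
open Filter Topology

variable {W : Type*} [Fintype W] [DecidableEq W] {d : ℕ}

omit [Fintype W] in
theorem continuous_edgeVec (a b : W) :
    Continuous fun p : W → Fin d → ℝ => edgeVec p a b := by
  refine continuous_pi fun wi => ?_
  unfold edgeVec
  split_ifs <;> fun_prop

omit [Fintype W] in
theorem edgeVec_comm (p : W → Fin d → ℝ) {a b : W} (h : a ≠ b) :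
    edgeVec p a b = edgeVec p b a := by
  ext wi
  unfold edgeVec
  split_ifs with h1 h2
  · exact absurd (h1.symm.trans h2) h
  all_goals rfl

theorem bddAbove_rankAt (F : Set (Sym2 W)) :
    BddAbove {n : ℕ | ∃ p : W → Fin d → ℝ, n = rankAt d p F} :=
  ⟨Module.finrank ℝ (W × Fin d → ℝ), by
    rintro _ ⟨p, rfl⟩
    exact Submodule.finrank_le _⟩

theorem rankAt_le_rd (p : W → Fin d → ℝ) (F : Set (Sym2 W)) : rankAt d p F ≤ rd d F :=
  le_csSup (bddAbove_rankAt F) ⟨p, rfl⟩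

/-- The rank of the rigidity matrix is lower semicontinuous. -/
theorem eventually_rankAt_le (p : W → Fin d → ℝ) (F : Set (Sym2 W)) :
    ∀ᶠ q in 𝓝 p, rankAt d p F ≤ rankAt d q F := by
  let f (q : W → Fin d → ℝ) (e : {e : W × W // s(e.1, e.2) ∈ F}) : W × Fin d → ℝ :=
    edgeVec q e.1.1 e.1.2
  have hf (q) : rowSpan q F = Submodule.span ℝ (Set.range (f q)) := by
    rw [rowSpan]
    congr 1
    ext x
    constructor
    · rintro ⟨u, v, h, rfl⟩
      exact ⟨⟨(u, v), h⟩, rfl⟩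
    · rintro ⟨e, rfl⟩
      exact ⟨_, _, e.2, rfl⟩
  obtain ⟨κ, a, ha, hspan, hli⟩ := exists_linearIndependent' ℝ (f p)
  have : Finite κ := Finite.of_injective a ha
  cases nonempty_fintype κ
  have hcont : Continuous fun q => f q ∘ a :=
    continuous_pi fun k => continuous_edgeVec _ _
  filter_upwards [hcont.continuousAt.eventually hli.eventually] with q hq
  calc rankAt d p F = Module.finrank ℝ (rowSpan p F) := rfl
    _ = Fintype.card κ := by rw [hf, ← hspan, finrank_span_eq_card hli]
    _ = Module.finrank ℝ (Submodule.span ℝ (Set.range (f q ∘ a))) := (finrank_span_eq_card hq).symm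
    _ ≤ Module.finrank ℝ (rowSpan q F) := by
      rw [hf]
      exact Submodule.finrank_mono (Submodule.span_mono (Set.range_comp_subset_range _ _))

/-- The rank of a generic rigidity matrix is attained at some generic placement. -/
theorem exists_generic_rd_le_rankAt (F : Set (Sym2 W)) :
    ∃ p : W → Fin d → ℝ, Generic p ∧ rd d F ≤ rankAt d p F := by
  obtain ⟨p, hp⟩ : rd d F ∈ {n : ℕ | ∃ p : W → Fin d → ℝ, n = rankAt d p F} :=
    Nat.sSup_mem ⟨_, 0, rfl⟩ (bddAbove_rankAt F)
  obtain ⟨q, hq, hgen⟩ := exists_generic_placement_mem_nhds (eventually_rankAt_le p F)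
  exact ⟨q, hgen, hp.trans_le hq⟩

theorem IsRdBridge.exists_generic {G : SimpleGraph W} {x y : W} (h : IsRdBridge d G s(x, y)) :
    ∃ p : W → Fin d → ℝ, Generic p ∧ edgeVec p x y ∉ rowSpan p (G.edgeSet \ {s(x, y)}) := by
  obtain ⟨p, hp, hrank⟩ := exists_generic_rd_le_rankAt (d := d) G.edgeSet
  refine ⟨p, hp, fun hmem => ?_⟩
  have hle : rowSpan p G.edgeSet ≤ rowSpan p (G.edgeSet \ {s(x, y)}) := by
    rw [rowSpan, Submodule.span_le]
    rintro _ ⟨u, v, huv, rfl⟩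
    by_cases he : s(u, v) = s(x, y)
    · rcases Sym2.eq_iff.mp he with ⟨rfl, rfl⟩ | ⟨rfl, rfl⟩
      · exact hmem
      · rwa [SetLike.mem_coe, edgeVec_comm p (G.ne_of_adj huv)]
    · exact Submodule.subset_span ⟨u, v, ⟨huv, he⟩, rfl⟩
  have h1 : rankAt d p G.edgeSet ≤ rankAt d p (G.edgeSet \ {s(x, y)}) :=
    Submodule.finrank_mono hle
  have h2 := rankAt_le_rd p (G.edgeSet \ {s(x, y)})
  have h3 := h.2
  omega

end Bridge

section Affine
open Filter Topology MvPolynomial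

variable {W : Type*} {d : ℕ}

/-- Distinct points of a generic placement, at most `d + 1` in number, are affinely
independent. -/
theorem Generic.affineIndependent {p : W → Fin d → ℝ} (hp : Generic p) {n : Fin (d + 1) → W}
    (hn : Function.Injective n) : AffineIndependent ℝ (fun i => p (n i)) := by
  classical
  let M : Matrix (Fin (d + 1)) (Fin (d + 1)) (MvPolynomial (W × Fin d) ℚ) :=
    Matrix.of fun i => Fin.cons 1 fun j => X (n i, j)
  have hM : M.det ≠ 0 := by
    intro h0
    let c : W × Fin d → ℚ := fun wj => if wj.1 = n wj.2.succ then 1 else 0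
    have h1 : ((eval c).mapMatrix M).det = 1 := by
      rw [Matrix.det_of_isLowerTriangular]
      · refine Finset.prod_eq_one fun i _ => ?_
        cases i using Fin.cases <;> simp [M, c]
      · intro i k hik
        have hik : i < k := hik
        cases k using Fin.cases with
        | zero => exact absurd hik (Fin.not_lt_zero i)
        | succ j => simp [M, c, hn.eq_iff, hik.ne]
    rw [← RingHom.map_det, h0, map_zero] at h1
    exact zero_ne_one h1
  have hdet : ((aeval (Function.uncurry p) : MvPolynomial (W × Fin d) ℚ →ₐ[ℚ] ℝ).mapMatrix
      M).det ≠ 0 := by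
    rw [← AlgHom.map_det]
    exact fun h => hM (hp (by rwa [map_zero]))
  rw [affineIndependent_iff]
  intro s w hw hsum
  have hv : (fun i => if i ∈ s then w i else 0) = 0 := by
    refine Matrix.eq_zero_of_vecMul_eq_zero hdet ?_
    ext k
    cases k using Fin.cases with
    | zero => simpa [Matrix.vecMul, dotProduct, M] using hw
    | succ j => simpa [Matrix.vecMul, dotProduct, M] using congrFun hsum j
  intro i hi
  simpa [hi] using congrFun hv i

/-- The affine basis formed by `d + 1` affinely independent points. -/
def affineBasisOf (a : Fin (d + 1) → Fin d → ℝ) (ha : AffineIndependent ℝ a) :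
    AffineBasis (Fin (d + 1)) ℝ (Fin d → ℝ) :=
  ⟨a, ha, ha.affineSpan_eq_top_iff_card_eq_finrank_add_one.mpr (by simp)⟩

theorem exists_barycentric {a : Fin (d + 1) → Fin d → ℝ} (ha : AffineIndependent ℝ a)
    (z : Fin d → ℝ) : ∃ l : Fin (d + 1) → ℝ, ∑ i, l i = 1 ∧ ∑ i, l i • a i = z :=
  ⟨fun i => (affineBasisOf a ha).coord i z, (affineBasisOf a ha).sum_coord_apply_eq_one z,
    (affineBasisOf a ha).linear_combination_coord_eq_self z⟩

end Affine

section Barycentric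
open Filter Topology MvPolynomial

variable {ι : Type*} [Fintype ι] {d : ℕ}

/-- The bilinear form polarizing `sqDist`. -/
def bil (a b α β : Fin d → ℝ) : ℝ := ∑ c, (a c - b c) * (α c - β c)

theorem bil_self (a b : Fin d → ℝ) : bil a b a b = sqDist a b :=
  Finset.sum_congr rfl fun _ _ => by ring

theorem sum_mul_sum_eq (l : ι → ℝ) (u v : ι → ℝ) :
    (∑ i, l i * u i) * (∑ i, l i * v i) = (∑ i, l i) * ∑ i, l i * (u i * v i) -
      (∑ i, ∑ j, l i * l j * ((u i - u j) * (v i - v j))) / 2 := by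
  have h : ∑ i, ∑ j, l i * l j * ((u i - u j) * (v i - v j)) =
      2 * ((∑ i, l i) * ∑ i, l i * (u i * v i)) -
        2 * ((∑ i, l i * u i) * (∑ i, l i * v i)) := by
    have h1 : ∀ i j, l i * l j * ((u i - u j) * (v i - v j)) =
        l i * (u i * v i) * l j + l i * (l j * (u j * v j)) -
          (l i * u i) * (l j * v j) - (l i * v i) * (l j * u j) := fun i j => by ring
    simp only [h1, Finset.sum_add_distrib, Finset.sum_sub_distrib, ← Finset.mul_sum,
      ← Finset.sum_mul]
    ring
  rw [h]
  ring

theorem sum_sum_mul_sum_eq (l : ι → ℝ) (a α : ι → Fin d → ℝ) (b β : Fin d → ℝ) :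
    ∑ c, (∑ i, l i * (a i c - b c)) * (∑ i, l i * (α i c - β c)) =
      (∑ i, l i) * ∑ i, l i * bil (a i) b (α i) β -
        (∑ i, ∑ j, l i * l j * bil (a i) (a j) (α i) (α j)) / 2 := by
  simp only [sum_mul_sum_eq, Finset.sum_sub_distrib, ← Finset.mul_sum, ← Finset.sum_div,
    sub_sub_sub_cancel_right]
  congr 2
  · rw [Finset.sum_comm]
    simp only [← Finset.mul_sum, bil]
  · rw [Finset.sum_comm]
    refine Finset.sum_congr rfl fun i _ => ?_
    rw [Finset.sum_comm]
    simp only [← Finset.mul_sum, bil]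

theorem bil_barycentric {l : ι → ℝ} (hl : ∑ i, l i = 1) {a α : ι → Fin d → ℝ}
    (b β : Fin d → ℝ) :
    bil (∑ i, l i • a i) b (∑ i, l i • α i) β = ∑ i, l i * bil (a i) b (α i) β -
        (∑ i, ∑ j, l i * l j * bil (a i) (a j) (α i) (α j)) / 2 := by
  have h := sum_sum_mul_sum_eq l a α b β
  simp only [mul_sub, Finset.sum_sub_distrib, ← Finset.sum_mul, hl, one_mul] at h
  rw [← h]
  simp [bil, Finset.sum_apply, mul_sub, Finset.sum_sub_distrib]

theorem sqDist_barycentric_sub {l : ι → ℝ} (hl : ∑ i, l i = 1) {a a' : ι → Fin d → ℝ}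
    (h : ∀ i j, sqDist (a' i) (a' j) = sqDist (a i) (a j)) (b b' : Fin d → ℝ) :
    sqDist (∑ i, l i • a' i) b' - sqDist (∑ i, l i • a i) b =
      ∑ i, l i * (sqDist (a' i) b' - sqDist (a i) b) := by
  have h1 := bil_barycentric (a := a) (α := a) hl b b
  have h2 := bil_barycentric (a := a') (α := a') hl b' b'
  simp only [bil_self, h] at h1 h2
  rw [h1, h2]
  simp only [mul_sub, Finset.sum_sub_distrib]
  ring

theorem affineIndependent_of_sqDist_eq {a a' : ι → Fin d → ℝ}
    (h : ∀ i j, sqDist (a' i) (a' j) = sqDist (a i) (a j)) (ha : AffineIndependent ℝ a) :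
    AffineIndependent ℝ a' := by
  classical
  rw [affineIndependent_iff] at ha ⊢
  intro s w hw hsum i hi
  let l : ι → ℝ := fun i => if i ∈ s then w i else 0
  have hl : ∑ i, l i = 0 := by simpa [l] using hw
  have hla (e : ι → Fin d → ℝ) (c : Fin d) : ∑ i, l i * (e i c - 0) = (∑ i ∈ s, w i • e i) c := by
    simp [l, Finset.sum_apply]
  have h1 := sum_sum_mul_sum_eq l a a 0 0
  have h2 := sum_sum_mul_sum_eq l a' a' 0 0
  simp only [Pi.zero_apply, hla, hl, bil_self, h, hsum, zero_mul] at h1 h2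
  rw [← h2, Finset.sum_const_zero, Finset.sum_eq_zero_iff_of_nonneg
    fun _ _ => mul_self_nonneg _] at h1
  refine ha s w hw (funext fun c => ?_) i hi
  simpa using h1 c (Finset.mem_univ c)

end Barycentric

section Motions
open Filter Topology

variable {W : Type*} [Fintype W] [DecidableEq W] {d : ℕ}

theorem linearCombination_edgeVec (p m : W → Fin d → ℝ) (a b : W) :
    Fintype.linearCombination ℝ (Function.uncurry m) (edgeVec p a b) =
      bil (p a) (p b) (m a) (m b) := by
  simp only [Fintype.linearCombination_apply, Fintype.sum_prod_type_right, bil, edgeVec]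
  refine Finset.sum_congr rfl fun c _ => ?_
  by_cases hab : a = b
  · subst hab
    simp
  · have h (w : W) : (if w = a then p a c - p b c else if w = b then p b c - p a c else 0) =
        (if w = a then p a c - p b c else 0) + if w = b then p b c - p a c else 0 := by
      split_ifs with h1 h2
      · exact absurd (h1.symm.trans h2) hab
      all_goals simp
    simp only [h, smul_eq_mul, add_mul, ite_mul, zero_mul, Finset.sum_add_distrib,
      Finset.sum_ite_eq', Finset.mem_univ, if_true, Function.uncurry]
    ring

theorem edgeVec_mem_rowSpan_iff_motion (p : W → Fin d → ℝ) (F : Set (Sym2 W)) (a b : W) :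
    edgeVec p a b ∈ rowSpan p F ↔ ∀ m : W → Fin d → ℝ,
      (∀ u v, s(u, v) ∈ F → bil (p u) (p v) (m u) (m v) = 0) →
        bil (p a) (p b) (m a) (m b) = 0 := by
  constructor
  · intro h m hm
    rw [← linearCombination_edgeVec]
    have hle : rowSpan p F ≤
        LinearMap.ker (Fintype.linearCombination ℝ (Function.uncurry m)) := by
      rw [rowSpan, Submodule.span_le]
      rintro _ ⟨u, v, huv, rfl⟩
      rw [SetLike.mem_coe, LinearMap.mem_ker, linearCombination_edgeVec, hm u v huv]
    exact hle h
  · intro h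
    by_contra hmem
    obtain ⟨φ, hφ, hle⟩ := Submodule.exists_le_ker_of_notMem hmem
    let m : W → Fin d → ℝ := fun w c => φ (Pi.single (w, c) 1)
    have hm : φ = Fintype.linearCombination ℝ (Function.uncurry m) := by
      refine LinearMap.ext fun x => ?_
      rw [LinearMap.pi_apply_eq_sum_univ φ x, Fintype.linearCombination_apply]
      refine Finset.sum_congr rfl fun wc _ => ?_
      congr 2
      ext wc'
      simp [Pi.single_apply, eq_comm]
    rw [hm] at hφ hle
    refine hφ ?_
    rw [linearCombination_edgeVec]
    refine h m fun u v huv => ?_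
    rw [← linearCombination_edgeVec]
    exact hle (Submodule.subset_span ⟨u, v, huv, rfl⟩)

end Motions

section Deletion
open Filter Topology

variable {V : Type*} [Fintype V] [DecidableEq V] {d : ℕ}

/-- If the edge `xy` is independent of the other edges, `y` has `d + 1` further neighbours in
general position, and these are pairwise linked in `G - y`, then `x` is not linked in `G - y`
to at least one of them. -/
theorem exists_edgeVec_notMem_rowSpan {G : SimpleGraph V} {y : V} {x : ({y}ᶜ : Set V)}
    {P : V → Fin d → ℝ} (hP : edgeVec P x y ∉ rowSpan P (G.edgeSet \ {s((x : V), y)}))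
    {n : Fin (d + 1) → ({y}ᶜ : Set V)} (hn : ∀ i, (n i : V) ∈ G.neighborSet y \ {(x : V)})
    (ha : AffineIndependent ℝ fun i => P (n i))
    (hlink : ∀ i j, edgeVec (fun w : ({y}ᶜ : Set V) => P w) (n i) (n j) ∈
      rowSpan (fun w : ({y}ᶜ : Set V) => P w) (G.induce ({y}ᶜ : Set V)).edgeSet) :
    ∃ k, edgeVec (fun w : ({y}ᶜ : Set V) => P w) x (n k) ∉
      rowSpan (fun w : ({y}ᶜ : Set V) => P w) (G.induce ({y}ᶜ : Set V)).edgeSet := by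
  by_contra! hx
  refine hP ((edgeVec_mem_rowSpan_iff_motion _ _ _ _).mpr fun m hm => ?_)
  have hres (a b : ({y}ᶜ : Set V)) (hab : edgeVec (fun w : ({y}ᶜ : Set V) => P w) a b ∈
      rowSpan (fun w : ({y}ᶜ : Set V) => P w) (G.induce ({y}ᶜ : Set V)).edgeSet) :
      bil (P a) (P b) (m a) (m b) = 0 := by
    refine (edgeVec_mem_rowSpan_iff_motion _ _ _ _).mp hab (fun w => m w) fun u v huv => ?_
    refine hm u v ⟨huv, fun h => ?_⟩
    rcases Sym2.eq_iff.mp h with ⟨-, h⟩ | ⟨h, -⟩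
    · exact v.2 h
    · exact u.2 h
  obtain ⟨l, hl, hz⟩ := exists_barycentric ha (P y)
  have hbil (w : ({y}ᶜ : Set V)) (hw : ∀ i, bil (P (n i)) (P w) (m (n i)) (m w) = 0) :
      bil (P y) (P w) (∑ i, l i • m (n i)) (m w) = 0 := by
    rw [← hz, bil_barycentric hl]
    simp [hw, fun i j => hres _ _ (hlink i j)]
  have hcomm {a b α β : Fin d → ℝ} : bil a b α β = bil b a β α :=
    Finset.sum_congr rfl fun _ _ => by ring
  let e : Fin d → ℝ := m y - ∑ i, l i • m (n i)
  have hsub (b β : Fin d → ℝ) : ∑ c, (P y c - b c) * e c =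
      bil (P y) b (m y) β - bil (P y) b (∑ i, l i • m (n i)) β := by
    rw [bil, bil, ← Finset.sum_sub_distrib]
    refine Finset.sum_congr rfl fun c _ => ?_
    simp only [e, Pi.sub_apply]
    ring
  have horth (k : Fin (d + 1)) : ∑ c, (P y c - P (n k) c) * e c = 0 := by
    rw [hsub _ (m (n k)), hbil _ fun i => hres _ _ (hlink i k), sub_zero]
    refine hm y (n k) ⟨(hn k).1, fun h => ?_⟩
    rcases Sym2.eq_iff.mp h with ⟨h, -⟩ | ⟨-, h⟩
    · exact x.2 h.symm
    · exact (hn k).2 h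
  have he : e = 0 := by
    obtain ⟨l', hl', hz'⟩ := exists_barycentric ha (P y - e)
    have h : ∑ c, e c * e c = ∑ k, l' k * ∑ c, (P y c - P (n k) c) * e c := by
      simp only [Finset.mul_sum]
      rw [Finset.sum_comm]
      refine Finset.sum_congr rfl fun c _ => ?_
      have hc := congrFun hz' c
      simp only [Finset.sum_apply, Pi.smul_apply, Pi.sub_apply, smul_eq_mul] at hc
      simp only [← mul_assoc, ← Finset.sum_mul, mul_sub, Finset.sum_sub_distrib, hc, hl']
      ring
    simp only [horth, mul_zero, Finset.sum_const_zero] at h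
    rw [Finset.sum_eq_zero_iff_of_nonneg fun _ _ => mul_self_nonneg _] at h
    exact funext fun c => by simpa using h c (Finset.mem_univ c)
  have h := hsub (P x) (m x)
  rw [hbil x fun i => hcomm.trans (hres _ _ (hx i)), he] at h
  rw [hcomm]
  simpa using h.symm

/-- The placement extending `p` by placing `y` at `z`. -/
def extend (y : V) (p : ({y}ᶜ : Set V) → Fin d → ℝ) (z : Fin d → ℝ) : V → Fin d → ℝ :=
  fun w => if h : w = y then z else p ⟨w, h⟩

omit [Fintype V] in
theorem extend_self (y : V) (p : ({y}ᶜ : Set V) → Fin d → ℝ) (z : Fin d → ℝ) :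
    extend y p z y = z := dif_pos rfl

omit [Fintype V] in
theorem extend_coe {y : V} (p : ({y}ᶜ : Set V) → Fin d → ℝ) (z : Fin d → ℝ)
    (w : ({y}ᶜ : Set V)) : extend y p z w = p w := dif_neg w.2

theorem Generic.exists_generic_extend {y : V} {p : ({y}ᶜ : Set V) → Fin d → ℝ}
    (hp : Generic p) {z : Fin d → ℝ} {U : Set (Fin d → ℝ)} (hU : U ∈ 𝓝 z) :
    ∃ z' ∈ U, Generic (extend y p z') := by
  have hS : AlgebraicIndepOn ℚ (Function.uncurry (extend y p z))
      {wi : V × Fin d | wi.1 ≠ y} := by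
    let e : {wi : V × Fin d | wi.1 ≠ y} → ({y}ᶜ : Set V) × Fin d :=
      fun wi => (⟨wi.1.1, wi.2⟩, wi.1.2)
    have he : Function.Injective e := fun a b hab => by
      obtain ⟨h1, h2⟩ := Prod.mk.inj hab
      exact Subtype.ext (Prod.ext (congrArg Subtype.val h1) h2)
    convert AlgebraicIndependent.comp hp e he using 1
    ext wi
    exact congrFun (extend_coe p z ⟨wi.1.1, wi.2⟩) wi.1.2
  have hc : Continuous fun (q : V × Fin d → ℝ) (i : Fin d) => q (y, i) := by fun_prop
  have hzU : (fun (q : V × Fin d → ℝ) (i : Fin d) => q (y, i)) ⁻¹' U ∈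
      𝓝 (Function.uncurry (extend y p z)) := by
    refine hc.continuousAt.preimage_mem_nhds ?_
    simpa [Function.uncurry, extend_self] using hU
  obtain ⟨q, hq, heq, hgen⟩ := exists_algebraicIndependent_mem_nhds hS hzU
  refine ⟨fun i => q (y, i), hq, ?_⟩
  suffices hext : (fun wi : V × Fin d => extend y p (fun i => q (y, i)) wi.1 wi.2) = q by
    rwa [Generic, hext]
  ext ⟨w, i⟩
  by_cases hw : w = y
  · subst hw
    simp [extend_self]
  · rw [heq (w, i) hw]
    simp [extend, hw, Function.uncurry]

end Deletion

section Forms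
open Filter Topology

variable {ι : Type*} [Fintype ι]

theorem mul_nonneg_of_forall_sum_eq_one [Nonempty ι] {a b : ι → ℝ}
    (h : ∀ l : ι → ℝ, ∑ i, l i = 1 → 0 ≤ (l ⬝ᵥ a) * (l ⬝ᵥ b)) (l : ι → ℝ) :
    0 ≤ (l ⬝ᵥ a) * (l ⬝ᵥ b) := by
  classical
  have hne (l : ι → ℝ) (hl : ∑ i, l i ≠ 0) : 0 ≤ (l ⬝ᵥ a) * (l ⬝ᵥ b) := by
    have h1 := h ((∑ i, l i)⁻¹ • l) (by simp [← Finset.mul_sum, hl])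
    rw [smul_dotProduct, smul_dotProduct, smul_eq_mul, smul_eq_mul, mul_mul_mul_comm] at h1
    exact nonneg_of_mul_nonneg_right h1 (mul_self_pos.mpr (inv_ne_zero hl))
  by_cases hl : ∑ i, l i = 0
  · obtain ⟨i₀⟩ := ‹Nonempty ι›
    let f (t : ℝ) : ι → ℝ := l + t • Pi.single i₀ 1
    have hf : Continuous fun t => (f t ⬝ᵥ a) * (f t ⬝ᵥ b) := by
      simp only [f, dotProduct]
      fun_prop
    have hlim : Tendsto (fun t => (f t ⬝ᵥ a) * (f t ⬝ᵥ b)) (𝓝[≠] 0)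
        (𝓝 ((l ⬝ᵥ a) * (l ⬝ᵥ b))) := by
      have h0 := hf.tendsto 0
      simp only [f, zero_smul, add_zero] at h0
      exact h0.mono_left nhdsWithin_le_nhds
    refine ge_of_tendsto hlim (eventually_mem_nhdsWithin.mono fun t ht => hne _ ?_)
    simpa [f, Finset.sum_add_distrib, hl, ← Finset.mul_sum] using ht
  · exact hne l hl

/-- If the product of two linear forms is nonnegative on an affine hyperplane avoiding the
origin, then the forms are proportional with a nonnegative factor. -/
theorem exists_eq_smul_of_mul_nonneg [Nonempty ι] {a b : ι → ℝ} (ha : a ≠ 0)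
    (h : ∀ l : ι → ℝ, ∑ i, l i = 1 → 0 ≤ (l ⬝ᵥ a) * (l ⬝ᵥ b)) : ∃ c : ℝ, 0 ≤ c ∧ b = c • a := by
  have h := mul_nonneg_of_forall_sum_eq_one h
  have hself (v : ι → ℝ) : 0 ≤ v ⬝ᵥ v := Finset.sum_nonneg fun _ _ => mul_self_nonneg _
  have hA : 0 < a ⬝ᵥ a := (hself a).lt_of_ne' fun h0 => ha (dotProduct_self_eq_zero.mp h0)
  have hC : 0 ≤ a ⬝ᵥ b := nonneg_of_mul_nonneg_right (h a) hA
  refine ⟨(a ⬝ᵥ b) / (a ⬝ᵥ a), div_nonneg hC hA.le, ?_⟩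
  let w := b - ((a ⬝ᵥ b) / (a ⬝ᵥ a)) • a
  have hwa : w ⬝ᵥ a = 0 := by
    simp only [w, sub_dotProduct, smul_dotProduct, smul_eq_mul, dotProduct_comm b a]
    field_simp
    ring
  have hwb : w ⬝ᵥ b = w ⬝ᵥ w := by
    conv_rhs => rw [show w = b - ((a ⬝ᵥ b) / (a ⬝ᵥ a)) • a from rfl, dotProduct_sub,
      dotProduct_smul]
    rw [show b - ((a ⬝ᵥ b) / (a ⬝ᵥ a)) • a = w from rfl, hwa, smul_zero, sub_zero]
  have hw : w = 0 := by
    by_contra hw0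
    have hpos : 0 < w ⬝ᵥ w := (hself w).lt_of_ne' fun h0 => hw0 (dotProduct_self_eq_zero.mp h0)
    have hle (t : ℝ) (ht : 0 < t) : w ⬝ᵥ w ≤ t * (a ⬝ᵥ b) := by
      have h1 := h (w - t • a)
      simp only [sub_dotProduct, smul_dotProduct, smul_eq_mul, hwa, hwb] at h1
      have h2 : 0 ≤ (t * (a ⬝ᵥ a)) * (t * (a ⬝ᵥ b) - w ⬝ᵥ w) := by linarith
      linarith [nonneg_of_mul_nonneg_right h2 (mul_pos ht hA)]
    rcases hC.eq_or_lt with hC | hC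
    · linarith [hle 1 one_pos]
    · have h1 := hle ((w ⬝ᵥ w) / (2 * (a ⬝ᵥ b))) (by positivity)
      have h2 : (w ⬝ᵥ w) / (2 * (a ⬝ᵥ b)) * (a ⬝ᵥ b) = (w ⬝ᵥ w) / 2 := by field_simp
      linarith
  exact sub_eq_zero.mp hw

theorem mul_pos_of_forall_ne_zero {f : ℝ → ℝ} {ε : ℝ} (hε : 0 ≤ ε)
    (hf : ContinuousOn f (Set.Icc 0 ε)) (h : ∀ s ∈ Set.Icc 0 ε, f s ≠ 0) : 0 < f 0 * f ε := by
  by_contra! hneg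
  rw [← Set.uIcc_of_le hε] at hf h
  have h0 : (0 : ℝ) ∈ Set.uIcc (f 0) (f ε) := by
    rcases mul_nonpos_iff.mp hneg with h1 | h1
    · exact Set.mem_uIcc_of_ge h1.2 h1.1
    · exact Set.mem_uIcc_of_le h1.1 h1.2
  obtain ⟨s, hs, hs0⟩ := intermediate_value_uIcc hf h0
  exact h s hs hs0

variable {d : ℕ}

/-- The vector of squared distances from affinely spanning points to a further point is an
extreme point of the set of such vectors. -/
theorem sqDist_eq_of_sub_eq_smul {N₁ N₂ N₃ : Fin (d + 1) → Fin d → ℝ} {x₁ x₂ x₃ : Fin d → ℝ}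
    (h₁ : ∀ i j, sqDist (N₁ i) (N₁ j) = sqDist (N₂ i) (N₂ j))
    (h₃ : ∀ i j, sqDist (N₃ i) (N₃ j) = sqDist (N₂ i) (N₂ j))
    (h₂ : AffineIndependent ℝ N₂) {θ : ℝ} (hθ₀ : 0 < θ) (hθ₁ : θ < 1)
    (h : ∀ i, sqDist (N₂ i) x₂ - sqDist (N₁ i) x₁ =
      θ * (sqDist (N₃ i) x₃ - sqDist (N₁ i) x₁)) (i : Fin (d + 1)) :
    sqDist (N₂ i) x₂ = sqDist (N₁ i) x₁ := by
  obtain ⟨l, hl, rfl⟩ := exists_barycentric h₂ x₂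
  have hself (a : Fin d → ℝ) : sqDist a a = 0 := by simp [sqDist]
  have e₁ := sqDist_barycentric_sub hl h₁ (∑ i, l i • N₂ i) x₁
  have e₃ := sqDist_barycentric_sub hl h₃ (∑ i, l i • N₂ i) x₃
  rw [hself, sub_zero] at e₁ e₃
  have hsum : (1 - θ) * sqDist (∑ i, l i • N₁ i) x₁ + θ * sqDist (∑ i, l i • N₃ i) x₃ = 0 := by
    rw [e₁, e₃, Finset.mul_sum, Finset.mul_sum, ← Finset.sum_add_distrib]
    exact Finset.sum_eq_zero fun i _ => by linear_combination -(l i) * h i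
  have hz : sqDist (∑ i, l i • N₁ i) x₁ = 0 := by
    nlinarith [mul_nonneg hθ₀.le (sqDist_nonneg (∑ i, l i • N₃ i) x₃),
      sqDist_nonneg (∑ i, l i • N₁ i) x₁]
  have hx : ∑ i, l i • N₁ i = x₁ := by
    rw [sqDist, Finset.sum_eq_zero_iff_of_nonneg fun _ _ => sq_nonneg _] at hz
    exact funext fun c => sub_eq_zero.mp
      (pow_eq_zero_iff two_ne_zero |>.mp (hz c (Finset.mem_univ c)))
  have e := sqDist_barycentric_sub hl h₁ (N₂ i) (N₁ i)
  simp only [h₁, sub_self, mul_zero, Finset.sum_const_zero, hx] at e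
  rw [sqDist_comm, sqDist_comm (N₁ i)]
  linarith

end Forms

section Extension
open Filter Topology

variable {V : Type*} [DecidableEq V] {d : ℕ}

theorem Equivalent.extend {G : SimpleGraph V} {y : V} {p q : ({y}ᶜ : Set V) → Fin d → ℝ}
    (h : Equivalent (G.induce ({y}ᶜ : Set V)) p q) {z z' : Fin d → ℝ}
    (hz : ∀ w : ({y}ᶜ : Set V), G.Adj y w → sqDist z (p w) = sqDist z' (q w)) :
    Equivalent G (extend y p z) (extend y q z') := by
  intro a b hab
  rw [eDist_eq_iff]
  by_cases ha : a = y
  · subst ha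
    have hb : b ∈ ({a}ᶜ : Set V) := hab.ne'
    simpa only [extend_self, extend_coe _ _ ⟨b, hb⟩] using hz ⟨b, hb⟩ hab
  · by_cases hb : b = y
    · subst hb
      rw [sqDist_comm, sqDist_comm (Rigidity.extend b q z' a)]
      have ha : a ∈ ({b}ᶜ : Set V) := ha
      simpa only [extend_self, extend_coe _ _ ⟨a, ha⟩] using hz ⟨a, ha⟩ hab.symm
    · have h1 := eDist_eq_iff.mp (h ⟨a, ha⟩ ⟨b, hb⟩ hab)
      simpa only [extend_coe _ _ ⟨a, ha⟩, extend_coe _ _ ⟨b, hb⟩] using h1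

/-- Extending two inequivalent realizations of `G - y` by the same barycentric coordinates of
`y` over linked neighbours cannot preserve the length of the remaining edge `xy`. -/
theorem GloballyLinked.sum_mul_sub_ne_zero {G : SimpleGraph V} {y : V} {x u v : ({y}ᶜ : Set V)}
    (hG : GloballyLinked d G (u : V) (v : V))
    {p q : ({y}ᶜ : Set V) → Fin d → ℝ} (hpq : Equivalent (G.induce ({y}ᶜ : Set V)) p q)
    (huv : sqDist (q u) (q v) ≠ sqDist (p u) (p v))
    (hnb : ∀ a b : ({y}ᶜ : Set V), (a : V) ∈ G.neighborSet y \ {(x : V)} →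
      (b : V) ∈ G.neighborSet y \ {(x : V)} → sqDist (q a) (q b) = sqDist (p a) (p b))
    {n : Fin (d + 1) → ({y}ᶜ : Set V)} (hn : ∀ i, (n i : V) ∈ G.neighborSet y \ {(x : V)})
    {l : Fin (d + 1) → ℝ} (hl : ∑ i, l i = 1)
    (hgen : Generic (Rigidity.extend y p (∑ i, l i • p (n i)))) :
    ∑ i, l i * (sqDist (q (n i)) (q x) - sqDist (p (n i)) (p x)) ≠ 0 := by
  intro h0
  have hcong : ∀ i j, sqDist (q (n i)) (q (n j)) = sqDist (p (n i)) (p (n j)) :=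
    fun i j => hnb _ _ (hn i) (hn j)
  refine huv ?_
  have h := hG _ hgen (Rigidity.extend y q (∑ i, l i • q (n i))) (hpq.extend fun w hw => ?_)
  · simpa only [extend_coe] using eDist_eq_iff.mp h
  · have hsub := sqDist_barycentric_sub hl hcong (p w) (q w)
    have hsum : ∑ i, l i * (sqDist (q (n i)) (q w) - sqDist (p (n i)) (p w)) = 0 := by
      by_cases hwx : w = x
      · rwa [hwx]
      · refine Finset.sum_eq_zero fun i _ => ?_
        rw [hnb _ _ (hn i) ⟨hw, fun h => hwx (Subtype.ext h)⟩, sub_self, mul_zero]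
    linarith

end Extension

section Deformation
open Filter Topology

variable {V : Type*} [Fintype V] [DecidableEq V] {d : ℕ}

theorem exists_injective_neighbors {G : SimpleGraph V} {x y : V}
    (hdeg : d + 2 ≤ (G.neighborSet y).ncard) :
    ∃ n : Fin (d + 1) → ({y}ᶜ : Set V), Function.Injective n ∧
      ∀ i, (n i : V) ∈ G.neighborSet y \ {x} := by
  classical
  have h1 := Set.pred_ncard_le_ncard_sdiff_singleton (G.neighborSet y) x
  have h2 : Fintype.card (Fin (d + 1)) ≤ Fintype.card ↥(G.neighborSet y \ {x}) := by
    rw [Fintype.card_fin, ← Nat.card_eq_fintype_card, Nat.card_coe_set_eq]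
    omega
  obtain ⟨f⟩ := Function.Embedding.nonempty_of_card_le h2
  have hy (i) : (f i : V) ∈ ({y}ᶜ : Set V) := (G.ne_of_adj (f i).2.1).symm
  exact ⟨fun i => ⟨f i, hy i⟩,
    fun i j hij => f.injective (Subtype.ext (Subtype.mk.inj hij)), fun i => (f i).2⟩

omit [Fintype V] [DecidableEq V] in
theorem Generic.restrict {P : V → Fin d → ℝ} (hP : Generic P) (S : Set V) :
    Generic fun w : S => P w :=
  AlgebraicIndependent.comp hP (fun wi : S × Fin d => ((wi.1 : V), wi.2))
    fun a b hab => by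
      obtain ⟨h1, h2⟩ := Prod.mk.inj hab
      exact Prod.ext (Subtype.ext h1) h2

theorem mul_nonneg_of_generic_extend {y : V} {p : ({y}ᶜ : Set V) → Fin d → ℝ} (hp : Generic p)
    {N : Fin (d + 1) → Fin d → ℝ} (hN : AffineIndependent ℝ N) {a b : Fin (d + 1) → ℝ}
    (h : ∀ l : Fin (d + 1) → ℝ, ∑ i, l i = 1 → Generic (extend y p (∑ i, l i • N i)) →
      0 ≤ (l ⬝ᵥ a) * (l ⬝ᵥ b)) (l : Fin (d + 1) → ℝ) (hl : ∑ i, l i = 1) :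
    0 ≤ (l ⬝ᵥ a) * (l ⬝ᵥ b) := by
  let B := affineBasisOf N hN
  let κ (z : Fin d → ℝ) (i : Fin (d + 1)) : ℝ := B.coord i z
  have hκ : Continuous κ :=
    continuous_pi fun i => AffineMap.continuous_of_finiteDimensional (B.coord i)
  have hκl : κ (∑ i, l i • N i) = l := by
    ext i
    have h1 := B.coord_apply_combination_of_mem (Finset.mem_univ i) hl
    rwa [Finset.affineCombination_eq_linear_combination _ _ _ hl] at h1
  by_contra! hneg
  have hopen : ∀ᶠ z in 𝓝 (∑ i, l i • N i), (κ z ⬝ᵥ a) * (κ z ⬝ᵥ b) < 0 := by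
    have hc : Continuous fun z => (κ z ⬝ᵥ a) * (κ z ⬝ᵥ b) := by
      simp only [dotProduct]
      fun_prop
    refine hc.continuousAt.eventually_lt continuousAt_const ?_
    rwa [hκl]
  obtain ⟨z, hz, hgen⟩ := hp.exists_generic_extend hopen
  have hsum : ∑ i, κ z i • N i = z := B.linear_combination_coord_eq_self z
  exact (not_le.mpr hz) (h (κ z) (B.sum_coord_apply_eq_one z) (by rwa [hsum]))

theorem not_globallyLinked_of_notMem_rowSpan {G : SimpleGraph V} {y : V}
    {x u v : ({y}ᶜ : Set V)}
    (hnb : ∀ a b : ({y}ᶜ : Set V), (a : V) ∈ G.neighborSet y \ {(x : V)} →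
      (b : V) ∈ G.neighborSet y \ {(x : V)} →
      GloballyLinked d (G.induce ({y}ᶜ : Set V)) a b)
    {n : Fin (d + 1) → ({y}ᶜ : Set V)} (hinj : Function.Injective n)
    (hn : ∀ i, (n i : V) ∈ G.neighborSet y \ {(x : V)}) {k : Fin (d + 1)}
    (hk : ∀ q : ({y}ᶜ : Set V) → Fin d → ℝ, Generic q →
      edgeVec q x (n k) ∉ rowSpan q (G.induce ({y}ᶜ : Set V)).edgeSet)
    (hnot : ¬ GloballyLinked d (G.induce ({y}ᶜ : Set V)) u v) :
    ¬ GloballyLinked d G (u : V) (v : V) := by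
  intro hG
  simp only [GloballyLinked, GloballyLinkedIn, not_forall] at hnot
  obtain ⟨p, hp, q, hpq, huv⟩ := hnot
  rw [eDist_eq_iff] at huv
  have hU : ∀ᶠ r : ({y}ᶜ : Set V) → Fin d → ℝ in 𝓝 q,
      sqDist (r u) (r v) ≠ sqDist (p u) (p v) := by
    have hc : Continuous fun r : ({y}ᶜ : Set V) → Fin d → ℝ => sqDist (r u) (r v) := by
      unfold sqDist
      fun_prop
    exact hc.continuousAt.eventually_ne huv
  obtain ⟨q', hq'U, hpq', hq'⟩ := hp.exists_generic_equivalent hpq (eventually_mem_nhds_iff.mpr hU)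
  obtain ⟨ε, hε, γ, hγc, hγ0, hγ⟩ := hq'.exists_path_equivalent (hk q' hq') hq'U
  have h0 : (0 : ℝ) ∈ Set.Icc 0 ε := ⟨le_rfl, hε.le⟩
  have h1 : ε ∈ Set.Icc 0 ε := ⟨hε.le, le_rfl⟩
  have hpγ (s) (hs : s ∈ Set.Icc 0 ε) : Equivalent (G.induce ({y}ᶜ : Set V)) p (γ s) :=
    fun a b hab => (hpq' a b hab).trans ((hγ s hs).2.1 a b hab)
  have hcong (s) (hs : s ∈ Set.Icc 0 ε) (a b : ({y}ᶜ : Set V))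
      (ha : (a : V) ∈ G.neighborSet y \ {(x : V)}) (hb : (b : V) ∈ G.neighborSet y \ {(x : V)}) :
      sqDist (γ s a) (γ s b) = sqDist (p a) (p b) :=
    eDist_eq_iff.mp (hnb a b ha hb p hp (γ s) (hpγ s hs))
  let δ (s : ℝ) (i : Fin (d + 1)) : ℝ := sqDist (γ s (n i)) (γ s x) - sqDist (p (n i)) (p x)
  have hδk (s) (hs : s ∈ Set.Icc 0 ε) : δ s k = δ 0 k + s := by
    simp only [δ, sqDist_comm _ (γ _ x), (hγ s hs).2.2, (hγ 0 h0).2.2]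
    ring
  have hindp : AffineIndependent ℝ fun i => p (n i) := hp.affineIndependent hinj
  have hindγ (s) (hs : s ∈ Set.Icc 0 ε) : AffineIndependent ℝ fun i => γ s (n i) :=
    affineIndependent_of_sqDist_eq (fun i j => hcong s hs _ _ (hn i) (hn j)) hindp
  have hne (s) (hs : s ∈ Set.Icc 0 ε) (l : Fin (d + 1) → ℝ) (hl : ∑ i, l i = 1)
      (hgen : Generic (extend y p (∑ i, l i • p (n i)))) : l ⬝ᵥ δ s ≠ 0 :=
    hG.sum_mul_sub_ne_zero (hpγ s hs) (hγ s hs).1 (hcong s hs) hn hl hgen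
  have hpos (l : Fin (d + 1) → ℝ) (hl : ∑ i, l i = 1)
      (hgen : Generic (extend y p (∑ i, l i • p (n i)))) : 0 < (l ⬝ᵥ δ 0) * (l ⬝ᵥ δ ε) := by
    refine mul_pos_of_forall_ne_zero (f := fun s => l ⬝ᵥ δ s) hε.le ?_
      fun s hs => hne s hs l hl hgen
    have hcd : Continuous fun r : ({y}ᶜ : Set V) → Fin d → ℝ =>
        l ⬝ᵥ fun i => sqDist (r (n i)) (r x) - sqDist (p (n i)) (p x) := by
      simp only [dotProduct, sqDist]
      fun_prop
    exact hcd.comp_continuousOn hγc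
  obtain ⟨l, hl, hgen⟩ : ∃ l : Fin (d + 1) → ℝ, ∑ i, l i = 1 ∧
      Generic (extend y p (∑ i, l i • p (n i))) := by
    obtain ⟨z, -, hz⟩ := hp.exists_generic_extend (z := 0) univ_mem
    obtain ⟨l, hl, hlz⟩ := exists_barycentric hindp z
    exact ⟨l, hl, by rwa [hlz]⟩
  have hδ (s) (hs : s ∈ Set.Icc 0 ε) : δ s ≠ 0 := fun h =>
    hne s hs l hl hgen (by rw [h, dotProduct_zero])
  obtain ⟨c, hc0, hc⟩ := exists_eq_smul_of_mul_nonneg (hδ 0 h0)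
    (mul_nonneg_of_generic_extend hp hindp fun l hl hgen => (hpos l hl hgen).le)
  have hci (i) : δ ε i = c * δ 0 i := congrFun hc i
  have hcpos : 0 < c := hc0.lt_of_ne fun h => hδ ε h1 (by rw [hc, ← h, zero_smul])
  rcases lt_trichotomy c 1 with hc1 | hc1 | hc1
  · refine hδ ε h1 (funext fun i => sub_eq_zero.mpr ?_)
    exact sqDist_eq_of_sub_eq_smul (N₁ := fun i => p (n i)) (N₂ := fun i => γ ε (n i))
      (N₃ := fun i => γ 0 (n i)) (fun i j => (hcong ε h1 _ _ (hn i) (hn j)).symm)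
      (fun i j => (hcong 0 h0 _ _ (hn i) (hn j)).trans (hcong ε h1 _ _ (hn i) (hn j)).symm)
      (hindγ ε h1) hcpos hc1 hci i
  · have h2 := hδk ε h1
    rw [hci, hc1] at h2
    linarith
  · refine hδ 0 h0 (funext fun i => sub_eq_zero.mpr ?_)
    refine sqDist_eq_of_sub_eq_smul (N₁ := fun i => p (n i)) (N₂ := fun i => γ 0 (n i))
      (N₃ := fun i => γ ε (n i)) (x₃ := γ ε x) (fun i j => (hcong 0 h0 _ _ (hn i) (hn j)).symm)
      (fun i j => (hcong ε h1 _ _ (hn i) (hn j)).trans (hcong 0 h0 _ _ (hn i) (hn j)).symm)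
      (hindγ 0 h0) (inv_pos.mpr hcpos) (inv_lt_one_of_one_lt₀ hc1) (fun i => ?_) i
    change δ 0 i = c⁻¹ * δ ε i
    rw [hci, inv_mul_cancel_left₀ hcpos.ne']

end Deformation

/-- Let `G` be `d`-rigid, `xy ∈ E` an `ℛ_d`-bridge with `deg_G(y) ≥ d+2`, and
suppose the vertices of `N_G(y) ∖ {x}` are pairwise globally `d`-linked in `G−y`.
If `{u,v}` (with `y ∉ {u,v}`) is not globally `d`-linked in `G−y`, then it is not
globally `d`-linked in `G`. -/
theorem not_globally_linked_of_bridge {V : Type*} [Fintype V] [DecidableEq V]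
    (d : ℕ) (hd : 1 ≤ d) (G : SimpleGraph V) (hG : IsRigidGraph d G)
    (x y : V) (hbridge : IsRdBridge d G s(x, y))
    (hdeg : d + 2 ≤ (G.neighborSet y).ncard)
    (hnb : ∀ a b : ({y}ᶜ : Set V),
      (a : V) ∈ G.neighborSet y \ {x} → (b : V) ∈ G.neighborSet y \ {x} →
      GloballyLinked d (G.induce ({y}ᶜ : Set V)) a b)
    (u v : ({y}ᶜ : Set V))
    (hnot : ¬ GloballyLinked d (G.induce ({y}ᶜ : Set V)) u v) :
    ¬ GloballyLinked d G (u : V) (v : V) := by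
  obtain ⟨P, hP, hxy⟩ := hbridge.exists_generic
  obtain ⟨n, hinj, hn⟩ := exists_injective_neighbors (x := x) hdeg
  have hPr := hP.restrict ({y}ᶜ : Set V)
  lift x to ({y}ᶜ : Set V) using G.ne_of_adj hbridge.1
  obtain ⟨k, hk⟩ := exists_edgeVec_notMem_rowSpan hxy hn (hPr.affineIndependent hinj)
    fun i j => (hnb _ _ (hn i) (hn j)).edgeVec_mem_rowSpan hPr
  exact not_globallyLinked_of_notMem_rowSpan hnb hinj hn
    (fun q hq => (hPr.edgeVec_mem_rowSpan_iff hq _ _ _).not.mp hk) hnot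

end Rigidity
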